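/- Let Ω ⊆ ℂ be a Denjoy domain of hyperbolic type with Ω ∩ ℝ = ⋃_{n≥0} (a_n, b_n), where the union is over a countable index set. Then the following conditions are equivalent: (1) the Poincaré metric h_Ω is Gromov δ-hyperbolic for some δ; (2) there exists a constant c₁ such that for every choice of fundamental geodesics {γ_n}_{n=1}^∞ one has h_Ω(z, ℝ) ≤ c₁ for every z ∈ ⋃_{n≥1} γ_n; (3) there exists a constant c₂ such that for one fixed choice of fundamental geodesics {γ_n}_{n=1}^∞ one has h_Ω(z, ℝ) ≤ c₂ for every z ∈ ⋃_{n≥1} γ_n; (4) there exists a constant c₃ such that every geodesic bigon in Ω with vertices in ℝ is c₃-thin. Moreover, the constant appearing in each of these conditions can be bounded in terms of the constant appearing in any other of them. -/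

import Mathlib

open Set Metric Filter Complex

noncomputable section

/-- The length of a curve `γ : [0,1] → E` with respect to the conformal density `ρ`. -/
def curveLen {E : Type*} [NormedAddCommGroup E] [NormedSpace ℝ E]
    (ρ : E → ℝ) (γ : ℝ → E) : ℝ :=
  ∫ t in (0:ℝ)..1, ρ (γ t) * ‖deriv γ t‖

/-- The distance induced on the set `S` by the conformal density `ρ`, defined as the infimum
of the `ρ`-lengths of C¹ curves joining the two points inside `S`. -/
def densityDist {E : Type*} [NormedAddCommGroup E] [NormedSpace ℝ E]
    (S : Set E) (ρ : E → ℝ) (z w : E) : ℝ :=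
  sInf { L | ∃ γ : ℝ → E, ContDiffOn ℝ 1 γ (Icc 0 1) ∧ γ 0 = z ∧ γ 1 = w ∧
      (∀ t ∈ Icc (0:ℝ) 1, γ t ∈ S) ∧ L = curveLen ρ γ }

/-- The quasihyperbolic density `1/δ_Ω(z)` of a domain `Ω`. -/
def qhDensity {E : Type*} [NormedAddCommGroup E] [NormedSpace ℝ E] (Ω : Set E) : E → ℝ :=
  fun z => (Metric.infDist z Ωᶜ)⁻¹

/-- The quasihyperbolic distance of a domain `Ω`. -/
def qhDist {E : Type*} [NormedAddCommGroup E] [NormedSpace ℝ E] (Ω : Set E) : E → E → ℝ :=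
  densityDist Ω (qhDensity Ω)

/-- `lam` is the density of the Poincaré (hyperbolic) metric of the plane domain `Ω`:
it is the pushforward of the density `2/(1-|z|²)` of the unit disk under a holomorphic
universal covering map `p : 𝔻 → Ω`. -/
def IsPoincareDensity (Ω : Set ℂ) (lam : ℂ → ℝ) : Prop :=
  ∃ p : ℂ → ℂ,
    (∀ z ∈ ball (0:ℂ) 1, DifferentiableAt ℂ p z) ∧
    p '' ball (0:ℂ) 1 = Ω ∧
    IsCoveringMapOn (fun z : ball (0:ℂ) 1 => p z) Ω ∧
    ∀ z ∈ ball (0:ℂ) 1, lam (p z) * ‖deriv p z‖ = 2 / (1 - ‖z‖ ^ 2)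

/-- `g` is a geodesic in `(S, d)` from `x` to `y`, parametrized by arclength on
`[0, d x y]`. -/
def IsGeodesicIn {α : Type*} (S : Set α) (d : α → α → ℝ) (g : ℝ → α) (x y : α) : Prop :=
  g 0 = x ∧ g (d x y) = y ∧ (∀ t ∈ Icc (0:ℝ) (d x y), g t ∈ S) ∧
  ∀ s ∈ Icc (0:ℝ) (d x y), ∀ t ∈ Icc (0:ℝ) (d x y), d (g s) (g t) = |s - t|

/-- Every geodesic triangle of `(S, d)` is `δ`-thin (Rips condition). -/
def GromovHyperbolicWith {α : Type*} (S : Set α) (d : α → α → ℝ) (δ : ℝ) : Prop :=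
  ∀ x ∈ S, ∀ y ∈ S, ∀ z ∈ S, ∀ gxy gxz gzy : ℝ → α,
    IsGeodesicIn S d gxy x y → IsGeodesicIn S d gxz x z → IsGeodesicIn S d gzy z y →
    ∀ t ∈ Icc (0:ℝ) (d x y),
      ∃ p ∈ gxz '' Icc (0:ℝ) (d x z) ∪ gzy '' Icc (0:ℝ) (d z y), d (gxy t) p ≤ δ

/-- `(S, d)` is Gromov hyperbolic: some `δ ≥ 0` works for all geodesic triangles. -/
def IsGromovHyperbolic {α : Type*} (S : Set α) (d : α → α → ℝ) : Prop :=
  ∃ δ : ℝ, 0 ≤ δ ∧ GromovHyperbolicWith S d δ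

/-- The real axis inside `ℂ`. -/
def realLine : Set ℂ := {z : ℂ | z.im = 0}

/-- A Denjoy domain: a domain whose boundary is contained in the real axis. -/
def IsDenjoyDomain (Ω : Set ℂ) : Prop :=
  IsOpen Ω ∧ IsConnected Ω ∧ frontier Ω ⊆ realLine

/-- The distance (for the distance function `d`) from a point to a set. -/
def distToSet {α : Type*} (d : α → α → ℝ) (z : α) (A : Set α) : ℝ :=
  sInf (d z '' A)

/-- A fundamental geodesic: a geodesic of `(S, d)` contained in the closed upper half plane,
joining a point of the boundary interval `I` (on the real axis) to a point of the boundary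
interval `J`. -/
def IsFundGeodesic (S : Set ℂ) (d : ℂ → ℂ → ℝ) (I J : Set ℝ) (g : ℝ → ℂ) (x y : ℂ) : Prop :=
  IsGeodesicIn S d g x y ∧ x.im = 0 ∧ x.re ∈ I ∧ y.im = 0 ∧ y.re ∈ J ∧
  ∀ t ∈ Icc (0:ℝ) (d x y), 0 ≤ (g t).im

end

noncomputable section

/-- Condition (2) of Theorem 3.3: every point of every fundamental geodesic is at distance
at most `c` from the real axis. -/
def DenjoyCondAllFund (Ω : Set ℂ) (d : ℂ → ℂ → ℝ) (I : ℕ → Set ℝ) (c : ℝ) : Prop :=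
  ∀ n : ℕ, 1 ≤ n → ∀ (g : ℝ → ℂ) (x y : ℂ), IsFundGeodesic Ω d (I 0) (I n) g x y →
    ∀ z ∈ g '' Icc (0:ℝ) (d x y), distToSet d z (Ω ∩ realLine) ≤ c

/-- Condition (3) of Theorem 3.3: for one fixed choice of fundamental geodesics, every point
of every chosen geodesic is at distance at most `c` from the real axis. -/
def DenjoyCondSomeFund (Ω : Set ℂ) (d : ℂ → ℂ → ℝ) (I : ℕ → Set ℝ) (c : ℝ) : Prop :=
  ∃ (g : ℕ → ℝ → ℂ) (x y : ℕ → ℂ),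
    (∀ n : ℕ, 1 ≤ n → IsFundGeodesic Ω d (I 0) (I n) (g n) (x n) (y n)) ∧
    ∀ n : ℕ, 1 ≤ n → ∀ z ∈ g n '' Icc (0:ℝ) (d (x n) (y n)),
      distToSet d z (Ω ∩ realLine) ≤ c

/-- Condition (4) of Theorem 3.3: every geodesic bigon with vertices in `ℝ` is `c`-thin. -/
def DenjoyCondBigon (Ω : Set ℂ) (d : ℂ → ℂ → ℝ) (c : ℝ) : Prop :=
  ∀ x ∈ Ω ∩ realLine, ∀ y ∈ Ω ∩ realLine, ∀ g₁ g₂ : ℝ → ℂ,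
    IsGeodesicIn Ω d g₁ x y → IsGeodesicIn Ω d g₂ x y →
    ∀ z ∈ g₁ '' Icc (0:ℝ) (d x y), ∃ w ∈ g₂ '' Icc (0:ℝ) (d x y), d z w ≤ c

section FoldedMetric

open scoped ComplexConjugate Topology

/-- Reflection of the lower half plane onto the upper half plane. -/
def foldUp (z : ℂ) : ℂ := ⟨z.re, |z.im|⟩

lemma foldUp_of_nonneg {z : ℂ} (h : 0 ≤ z.im) : foldUp z = z := by
  apply Complex.ext <;> simp [foldUp, abs_of_nonneg h]

lemma foldUp_of_nonpos {z : ℂ} (h : z.im ≤ 0) : foldUp z = conj z := by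
  apply Complex.ext <;> simp [foldUp, abs_of_nonpos h]

lemma foldUp_im_nonneg (z : ℂ) : 0 ≤ (foldUp z).im := abs_nonneg _

/-- `A` is the trace of a geodesic of `(Ω, d)` from `x` to `y`. -/
def GeodSeg (Ω : Set ℂ) (d : ℂ → ℂ → ℝ) (A : Set ℂ) (x y : ℂ) : Prop :=
  x ∈ Ω ∧ y ∈ Ω ∧ ∃ g : ℝ → ℂ, IsGeodesicIn Ω d g x y ∧ A = g '' Icc (0:ℝ) (d x y)

/-- A geodesic pseudometric on a plane set which is symmetric about the real axis, and whose
restriction to the closed upper half plane satisfies the four point condition of Gromov. -/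
structure IsFoldedMetric (Ω : Set ℂ) (d : ℂ → ℂ → ℝ) (K : ℝ) : Prop where
  const_nonneg : 0 ≤ K
  dist_self : ∀ x ∈ Ω, d x x = 0
  symm : ∀ x ∈ Ω, ∀ y ∈ Ω, d x y = d y x
  triangle : ∀ x ∈ Ω, ∀ y ∈ Ω, ∀ z ∈ Ω, d x z ≤ d x y + d y z
  conj_mem : ∀ x ∈ Ω, conj x ∈ Ω
  conj_le : ∀ x ∈ Ω, ∀ y ∈ Ω, d (conj x) (conj y) ≤ d x y
  fold_le : ∀ x ∈ Ω, ∀ y ∈ Ω, d (foldUp x) (foldUp y) ≤ d x y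
  exists_geodesic : ∀ x ∈ Ω, ∀ y ∈ Ω, ∃ g : ℝ → ℂ, IsGeodesicIn Ω d g x y
  continuousOn_im : ∀ x ∈ Ω, ∀ y ∈ Ω, ∀ g : ℝ → ℂ, IsGeodesicIn Ω d g x y →
    ContinuousOn (fun t => (g t).im) (Icc 0 (d x y))
  four_point : ∀ a ∈ Ω, ∀ b ∈ Ω, ∀ c ∈ Ω, ∀ e ∈ Ω,
    0 ≤ a.im → 0 ≤ b.im → 0 ≤ c.im → 0 ≤ e.im →
    d a c + d b e ≤ max (d a b + d c e) (d a e + d b c) + K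
  conj_near : ∀ x ∈ Ω, ∀ y ∈ Ω, x.im = 0 → y.im = 0 →
    (∀ r ∈ uIcc x.re y.re, (r : ℂ) ∈ Ω) → ∀ w ∈ Ω, 0 ≤ w.im →
    d x w + d w y = d x y → d w (conj w) ≤ K

namespace IsFoldedMetric

variable {Ω : Set ℂ} {d : ℂ → ℂ → ℝ} {K : ℝ}

lemma dist_nonneg (M : IsFoldedMetric Ω d K) {x y : ℂ} (hx : x ∈ Ω) (hy : y ∈ Ω) :
    0 ≤ d x y := by
  have h1 := M.triangle x hx y hy x hx
  have h2 := M.dist_self x hx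
  have h3 := M.symm x hx y hy
  linarith

lemma fold_mem (M : IsFoldedMetric Ω d K) {x : ℂ} (hx : x ∈ Ω) : foldUp x ∈ Ω := by
  rcases le_total 0 x.im with h | h
  · rwa [foldUp_of_nonneg h]
  · rw [foldUp_of_nonpos h]; exact M.conj_mem x hx

lemma conj_eq (M : IsFoldedMetric Ω d K) {x y : ℂ} (hx : x ∈ Ω) (hy : y ∈ Ω) :
    d (conj x) (conj y) = d x y := by
  refine le_antisymm (M.conj_le x hx y hy) ?_
  simpa using M.conj_le _ (M.conj_mem x hx) _ (M.conj_mem y hy)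

lemma seg_subset (_M : IsFoldedMetric Ω d K) {A : Set ℂ} {x y : ℂ} (h : GeodSeg Ω d A x y) :
    A ⊆ Ω := by
  obtain ⟨-, -, g, hg, rfl⟩ := h
  rintro _ ⟨t, ht, rfl⟩
  exact hg.2.2.1 t ht

lemma left_mem (M : IsFoldedMetric Ω d K) {A : Set ℂ} {x y : ℂ} (h : GeodSeg Ω d A x y) :
    x ∈ A := by
  obtain ⟨hx, hy, g, hg, rfl⟩ := h
  exact ⟨0, ⟨le_rfl, M.dist_nonneg hx hy⟩, hg.1⟩

lemma right_mem (M : IsFoldedMetric Ω d K) {A : Set ℂ} {x y : ℂ} (h : GeodSeg Ω d A x y) :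
    y ∈ A := by
  obtain ⟨hx, hy, g, hg, rfl⟩ := h
  exact ⟨d x y, ⟨M.dist_nonneg hx hy, le_rfl⟩, hg.2.1⟩

lemma exists_seg (M : IsFoldedMetric Ω d K) {x y : ℂ} (hx : x ∈ Ω) (hy : y ∈ Ω) :
    ∃ A, GeodSeg Ω d A x y := by
  obtain ⟨g, hg⟩ := M.exists_geodesic x hx y hy
  exact ⟨_, hx, hy, g, hg, rfl⟩

lemma seg_symm (M : IsFoldedMetric Ω d K) {A : Set ℂ} {x y : ℂ} (h : GeodSeg Ω d A x y) :
    GeodSeg Ω d A y x := by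
  obtain ⟨hx, hy, g, hg, rfl⟩ := h
  have hs := M.symm x hx y hy
  refine ⟨hy, hx, fun t => g (d x y - t), ⟨?_, ?_, ?_, ?_⟩, ?_⟩
  · simpa using hg.2.1
  · simpa [hs] using hg.1
  · intro t ht
    rw [← hs] at ht
    exact hg.2.2.1 _ ⟨by linarith [ht.2], by linarith [ht.1]⟩
  · intro s hs' t ht
    rw [← hs] at ht hs'
    rw [hg.2.2.2 _ ⟨by linarith [hs'.2], by linarith [hs'.1]⟩ _
      ⟨by linarith [ht.2], by linarith [ht.1]⟩, abs_sub_comm]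
    congr 1; ring
  · rw [← hs]
    ext w
    constructor
    · rintro ⟨t, ht, rfl⟩
      exact ⟨d x y - t, ⟨by linarith [ht.2], by linarith [ht.1]⟩, by simp⟩
    · rintro ⟨t, ht, rfl⟩
      exact ⟨d x y - t, ⟨by linarith [ht.2], by linarith [ht.1]⟩, rfl⟩

lemma seg_map (M : IsFoldedMetric Ω d K) {A : Set ℂ} {x y : ℂ} (h : GeodSeg Ω d A x y)
    {f : ℂ → ℂ} (hf : ∀ a ∈ Ω, f a ∈ Ω) (hfd : ∀ a ∈ Ω, ∀ b ∈ Ω, d (f a) (f b) ≤ d a b)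
    (hxy : d (f x) (f y) = d x y) : GeodSeg Ω d (f '' A) (f x) (f y) := by
  obtain ⟨hx, hy, g, hg, rfl⟩ := h
  have h0 := M.dist_nonneg hx hy
  have key : ∀ s ∈ Icc (0:ℝ) (d x y), ∀ t ∈ Icc (0:ℝ) (d x y), s ≤ t →
      d (f (g s)) (f (g t)) = |s - t| := by
    intro s hs t ht hst
    have gs := hg.2.2.1 s hs
    have gt := hg.2.2.1 t ht
    have h1 := hfd _ gs _ gt
    have h2 := hfd _ hx _ gs
    have h3 := hfd _ gt _ hy
    rw [hg.2.2.2 s hs t ht] at h1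
    have e2 := hg.2.2.2 _ ⟨le_rfl, h0⟩ _ hs
    rw [hg.1] at e2
    rw [e2] at h2
    have e3 := hg.2.2.2 _ ht _ ⟨h0, le_rfl⟩
    rw [hg.2.1] at e3
    rw [e3] at h3
    have h4 := M.triangle _ (hf _ hx) _ (hf _ gs) _ (hf _ hy)
    have h5 := M.triangle _ (hf _ gs) _ (hf _ gt) _ (hf _ hy)
    rw [abs_of_nonpos (by linarith)] at h1 ⊢
    rw [abs_of_nonpos (by linarith [hs.1])] at h2
    rw [abs_of_nonpos (by linarith [ht.2])] at h3
    linarith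
  refine ⟨hf x hx, hf y hy, f ∘ g, ⟨by simp [hg.1], by simp [hxy, hg.2.1], ?_, ?_⟩, ?_⟩
  · intro t ht
    rw [hxy] at ht
    exact hf _ (hg.2.2.1 t ht)
  · intro s hs t ht
    rw [hxy] at hs ht
    rcases le_total s t with hst | hst
    · exact key s hs t ht hst
    · simp only [Function.comp_apply]
      rw [M.symm _ (hf _ (hg.2.2.1 s hs)) _ (hf _ (hg.2.2.1 t ht)), abs_sub_comm]
      exact key t ht s hs hst
  · rw [hxy, image_comp]

lemma seg_conj (M : IsFoldedMetric Ω d K) {A : Set ℂ} {x y : ℂ} (h : GeodSeg Ω d A x y) :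
    GeodSeg Ω d (conj '' A) (conj x) (conj y) :=
  M.seg_map h (f := conj) M.conj_mem M.conj_le (M.conj_eq h.1 h.2.1)

lemma seg_fold (M : IsFoldedMetric Ω d K) {A : Set ℂ} {x y : ℂ} (h : GeodSeg Ω d A x y)
    (hx : 0 ≤ x.im) (hy : 0 ≤ y.im) : GeodSeg Ω d (foldUp '' A) x y := by
  have := M.seg_map h (f := foldUp) (fun a ha => M.fold_mem ha) M.fold_le
    (by rw [foldUp_of_nonneg hx, foldUp_of_nonneg hy])
  rwa [foldUp_of_nonneg hx, foldUp_of_nonneg hy] at this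

lemma seg_sub (_M : IsFoldedMetric Ω d K) {x y : ℂ} {g : ℝ → ℂ}
    (hg : IsGeodesicIn Ω d g x y) {s t : ℝ} (hs : 0 ≤ s) (hst : s ≤ t) (ht : t ≤ d x y) :
    GeodSeg Ω d (g '' Icc s t) (g s) (g t) := by
  have hs' : s ∈ Icc (0:ℝ) (d x y) := ⟨hs, hst.trans ht⟩
  have ht' : t ∈ Icc (0:ℝ) (d x y) := ⟨hs.trans hst, ht⟩
  have hd : d (g s) (g t) = t - s := by
    rw [hg.2.2.2 s hs' t ht', abs_sub_comm, abs_of_nonneg (by linarith)]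
  have hm : ∀ r ∈ Icc 0 (t - s), s + r ∈ Icc 0 (d x y) := fun r hr =>
    ⟨by linarith [hr.1], by linarith [hr.2]⟩
  refine ⟨hg.2.2.1 s hs', hg.2.2.1 t ht', fun r => g (s + r), ⟨by simp, by simp [hd], ?_, ?_⟩, ?_⟩
  · intro r hr
    rw [hd] at hr
    exact hg.2.2.1 _ (hm r hr)
  · intro a ha b hb
    rw [hd] at ha hb
    rw [hg.2.2.2 _ (hm a ha) _ (hm b hb)]
    congr 1; ring
  · rw [hd]
    ext w
    constructor
    · rintro ⟨r, hr, rfl⟩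
      exact ⟨r - s, ⟨by linarith [hr.1], by linarith [hr.2]⟩, by simp⟩
    · rintro ⟨r, hr, rfl⟩
      exact ⟨s + r, ⟨by linarith [hr.1], by linarith [hr.2]⟩, rfl⟩

lemma seg_split (M : IsFoldedMetric Ω d K) {A : Set ℂ} {x y w : ℂ} (h : GeodSeg Ω d A x y)
    (hw : w ∈ A) : ∃ A₁ A₂, GeodSeg Ω d A₁ x w ∧ GeodSeg Ω d A₂ w y ∧ A = A₁ ∪ A₂ ∧
      ∀ a ∈ A₁, ∀ b ∈ A₂, d a b = d a w + d w b := by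
  obtain ⟨hx, hy, g, hg, rfl⟩ := h
  obtain ⟨t, ht, rfl⟩ := hw
  refine ⟨g '' Icc 0 t, g '' Icc t (d x y), ?_, ?_, ?_, ?_⟩
  · simpa [hg.1] using M.seg_sub hg le_rfl ht.1 ht.2
  · simpa [hg.2.1] using M.seg_sub hg ht.1 ht.2 le_rfl
  · rw [← image_union, Icc_union_Icc_eq_Icc ht.1 ht.2]
  · rintro _ ⟨a, ha, rfl⟩ _ ⟨b, hb, rfl⟩
    have ha' : a ∈ Icc (0:ℝ) (d x y) := ⟨ha.1, ha.2.trans ht.2⟩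
    have hb' : b ∈ Icc (0:ℝ) (d x y) := ⟨ht.1.trans hb.1, hb.2⟩
    rw [hg.2.2.2 _ ha' _ hb', hg.2.2.2 _ ha' _ ht, hg.2.2.2 _ ht _ hb',
      abs_of_nonpos (by linarith [ha.2, hb.1]), abs_of_nonpos (by linarith [ha.2]),
      abs_of_nonpos (by linarith [hb.1])]
    ring

lemma seg_add (M : IsFoldedMetric Ω d K) {A : Set ℂ} {x y w : ℂ} (h : GeodSeg Ω d A x y)
    (hw : w ∈ A) : d x w + d w y = d x y := by
  obtain ⟨A₁, A₂, h₁, h₂, -, h₃⟩ := M.seg_split h hw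
  exact (h₃ x (M.left_mem h₁) y (M.right_mem h₂)).symm

lemma seg_exists_dist_eq (M : IsFoldedMetric Ω d K) {A : Set ℂ} {x y : ℂ}
    (h : GeodSeg Ω d A x y) {r : ℝ} (hr : 0 ≤ r) (hr' : r ≤ d x y) :
    ∃ p ∈ A, d x p = r ∧ d p y = d x y - r := by
  obtain ⟨p, hp, hpr⟩ : ∃ p ∈ A, d x p = r := by
    obtain ⟨hx, hy, g, hg, rfl⟩ := h
    refine ⟨g r, ⟨r, ⟨hr, hr'⟩, rfl⟩, ?_⟩
    nth_rewrite 1 [← hg.1]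
    rw [hg.2.2.2 _ ⟨le_rfl, hr.trans hr'⟩ _ ⟨hr, hr'⟩]
    simp [abs_of_nonneg hr]
  exact ⟨p, hp, hpr, by linarith [M.seg_add h hp]⟩

lemma seg_exists_real (M : IsFoldedMetric Ω d K) {A : Set ℂ} {x y : ℂ} (h : GeodSeg Ω d A x y)
    (hx : 0 ≤ x.im) (hy : y.im ≤ 0) : ∃ u ∈ A, u.im = 0 := by
  obtain ⟨hxΩ, hyΩ, g, hg, rfl⟩ := h
  have h0 := M.dist_nonneg hxΩ hyΩ
  have := intermediate_value_Icc' h0 (M.continuousOn_im x hxΩ y hyΩ g hg)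
  obtain ⟨t, ht, h⟩ := this (show (0:ℝ) ∈ Icc (g (d x y)).im (g 0).im from
    ⟨by rwa [hg.2.1], by rwa [hg.1]⟩)
  exact ⟨g t, ⟨t, ht, rfl⟩, h⟩

/-- `z` lies at distance at most `r` from the real points of `Ω`. -/
def NearReal (Ω : Set ℂ) (d : ℂ → ℂ → ℝ) (z : ℂ) (r : ℝ) : Prop :=
  ∃ u ∈ Ω, u.im = 0 ∧ d z u ≤ r

lemma nearReal_of_opposite (M : IsFoldedMetric Ω d K) {z w : ℂ} (hz : z ∈ Ω) (hw : w ∈ Ω)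
    (hzi : 0 ≤ z.im) (hwi : w.im ≤ 0) : NearReal Ω d z (d z w) := by
  obtain ⟨A, hA⟩ := M.exists_seg hz hw
  obtain ⟨u, hu, hui⟩ := M.seg_exists_real hA hzi hwi
  have := M.seg_add hA hu
  have := M.dist_nonneg (M.seg_subset hA hu) hw
  exact ⟨u, M.seg_subset hA hu, hui, by linarith⟩

lemma nearReal_trans (M : IsFoldedMetric Ω d K) {z w : ℂ} {r s : ℝ} (hz : z ∈ Ω) (hw : w ∈ Ω)
    (hzw : d z w ≤ s) (h : NearReal Ω d w r) : NearReal Ω d z (s + r) := by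
  obtain ⟨u, hu, hui, hur⟩ := h
  exact ⟨u, hu, hui, by linarith [M.triangle z hz w hw u hu]⟩

lemma nearReal_conj (M : IsFoldedMetric Ω d K) {z : ℂ} {r : ℝ} (hz : z ∈ Ω)
    (h : NearReal Ω d z r) : NearReal Ω d (conj z) r := by
  obtain ⟨u, hu, hui, hur⟩ := h
  refine ⟨conj u, M.conj_mem u hu, by simp [hui], ?_⟩
  rwa [M.conj_eq hz hu]

lemma nearReal_of_fold (M : IsFoldedMetric Ω d K) {z : ℂ} {r : ℝ} (hz : z ∈ Ω)
    (h : NearReal Ω d (foldUp z) r) : NearReal Ω d z r := by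
  rcases le_total 0 z.im with hi | hi
  · rwa [foldUp_of_nonneg hi] at h
  · rw [foldUp_of_nonpos hi] at h
    simpa using M.nearReal_conj (M.conj_mem z hz) h

lemma dist_conj_le (M : IsFoldedMetric Ω d K) {z : ℂ} {r : ℝ} (hz : z ∈ Ω)
    (h : NearReal Ω d z r) : d z (conj z) ≤ 2 * r := by
  obtain ⟨u, hu, hui, hur⟩ := h
  have h1 := M.triangle z hz u hu _ (M.conj_mem z hz)
  have h2 := M.conj_eq hu hz
  rw [Complex.conj_eq_iff_im.2 hui, M.symm u hu z hz] at h2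
  linarith

lemma dist_foldUp_le (M : IsFoldedMetric Ω d K) {z : ℂ} {r : ℝ} (hz : z ∈ Ω)
    (h : NearReal Ω d z r) : d z (foldUp z) ≤ 2 * r := by
  rcases le_total 0 z.im with hi | hi
  · rw [foldUp_of_nonneg hi, M.dist_self z hz]
    obtain ⟨u, hu, -, hur⟩ := h
    linarith [M.dist_nonneg hz hu]
  · rw [foldUp_of_nonpos hi]
    exact M.dist_conj_le hz h

lemma exists_near_of_almost_between (M : IsFoldedMetric Ω d K) {B : Set ℂ} {x z w : ℂ}
    (hB : GeodSeg Ω d B x z) (hBi : ∀ p ∈ B, 0 ≤ p.im) (hw : w ∈ Ω) (hwi : 0 ≤ w.im)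
    (h : d x w + d w z ≤ d x z + K) : ∃ p ∈ B, d w p ≤ 2 * K := by
  have hxi := hBi x (M.left_mem hB)
  have hzi := hBi z (M.right_mem hB)
  have hK := M.const_nonneg
  rcases le_total (d x w) (d x z) with hle | hle
  · obtain ⟨p, hp, hp1, hp2⟩ := M.seg_exists_dist_eq hB (M.dist_nonneg hB.1 hw) hle
    refine ⟨p, hp, ?_⟩
    have hpΩ := M.seg_subset hB hp
    have := M.four_point w hw x hB.1 p hpΩ z hB.2.1 hwi hxi (hBi p hp) hzi
    rw [M.symm w hw x hB.1] at this
    have h2 : max (d x w + d p z) (d w z + d x p) ≤ d x z + K :=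
      max_le (by linarith) (by linarith)
    linarith
  · exact ⟨z, M.right_mem hB, by linarith⟩

lemma thin_upper (M : IsFoldedMetric Ω d K) {A B C : Set ℂ} {x y z w : ℂ}
    (hA : GeodSeg Ω d A x y) (hB : GeodSeg Ω d B x z) (hC : GeodSeg Ω d C z y)
    (hAi : ∀ p ∈ A, 0 ≤ p.im) (hBi : ∀ p ∈ B, 0 ≤ p.im) (hCi : ∀ p ∈ C, 0 ≤ p.im)
    (hw : w ∈ A) : ∃ p ∈ B ∪ C, d w p ≤ 2 * K := by
  have hwΩ := M.seg_subset hA hw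
  have hwi := hAi w hw
  have h4 := M.four_point x hA.1 w hwΩ y hA.2.1 z hB.2.1 (hBi x (M.left_mem hB)) hwi
    (hCi y (M.right_mem hC)) (hBi z (M.right_mem hB))
  have hadd := M.seg_add hA hw
  rcases max_cases (d x w + d y z) (d x z + d w y) with ⟨he, -⟩ | ⟨he, -⟩
  · rw [he, M.symm y hA.2.1 z hB.2.1] at h4
    have h5 := M.symm z hB.2.1 w hwΩ
    obtain ⟨p, hp, hpd⟩ := M.exists_near_of_almost_between hC hCi hwΩ hwi (by linarith)
    exact ⟨p, Or.inr hp, hpd⟩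
  · rw [he] at h4
    obtain ⟨p, hp, hpd⟩ := M.exists_near_of_almost_between hB hBi hwΩ hwi (by linarith)
    exact ⟨p, Or.inl hp, hpd⟩

lemma exists_seg_upper (M : IsFoldedMetric Ω d K) {x y : ℂ} (hx : x ∈ Ω) (hy : y ∈ Ω)
    (hxi : 0 ≤ x.im) (hyi : 0 ≤ y.im) : ∃ A, GeodSeg Ω d A x y ∧ ∀ p ∈ A, 0 ≤ p.im := by
  obtain ⟨A, hA⟩ := M.exists_seg hx hy
  refine ⟨_, M.seg_fold hA hxi hyi, ?_⟩
  rintro _ ⟨p, -, rfl⟩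
  exact foldUp_im_nonneg p

/-- All geodesics of the closed upper half plane from `x` to `y` stay `r`-close to the reals. -/
def NearSeg (Ω : Set ℂ) (d : ℂ → ℂ → ℝ) (x y : ℂ) (r : ℝ) : Prop :=
  ∀ A, GeodSeg Ω d A x y → (∀ p ∈ A, 0 ≤ p.im) → ∀ w ∈ A, NearReal Ω d w r

lemma nearSeg_symm (M : IsFoldedMetric Ω d K) {x y : ℂ} {r : ℝ} (h : NearSeg Ω d x y r) :
    NearSeg Ω d y x r := fun A hA => h A (M.seg_symm hA)

lemma nearSeg_trans (M : IsFoldedMetric Ω d K) {x y z : ℂ} {r s : ℝ} (hz : z ∈ Ω)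
    (hzi : 0 ≤ z.im) (hxz : NearSeg Ω d x z r) (hzy : NearSeg Ω d z y s) :
    NearSeg Ω d x y (2 * K + max r s) := by
  intro A hA hAi w hw
  obtain ⟨B, hB, hBi⟩ := M.exists_seg_upper hA.1 hz (hAi x (M.left_mem hA)) hzi
  obtain ⟨C, hC, hCi⟩ := M.exists_seg_upper hz hA.2.1 hzi (hAi y (M.right_mem hA))
  obtain ⟨p, hp, hpd⟩ := M.thin_upper hA hB hC hAi hBi hCi hw
  have hwΩ := M.seg_subset hA hw
  rcases hp with hp | hp
  · obtain ⟨u, hu, hui, hur⟩ := hxz B hB hBi p hp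
    exact M.nearReal_trans hwΩ (M.seg_subset hB hp) hpd ⟨u, hu, hui, hur.trans (le_max_left _ _)⟩
  · obtain ⟨u, hu, hui, hur⟩ := hzy C hC hCi p hp
    exact M.nearReal_trans hwΩ (M.seg_subset hC hp) hpd ⟨u, hu, hui, hur.trans (le_max_right _ _)⟩

lemma nearSeg_of_seg (M : IsFoldedMetric Ω d K) {B : Set ℂ} {x y : ℂ} {r : ℝ}
    (hB : GeodSeg Ω d B x y) (hBi : ∀ p ∈ B, 0 ≤ p.im) (h : ∀ w ∈ B, NearReal Ω d w r) :
    NearSeg Ω d x y (2 * K + r) := by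
  intro A hA hAi w hw
  have hwΩ := M.seg_subset hA hw
  obtain ⟨p, hp, hpd⟩ := M.exists_near_of_almost_between hB hBi hwΩ (hAi w hw)
    (by linarith [M.seg_add hA hw, M.const_nonneg])
  exact M.nearReal_trans hwΩ (M.seg_subset hB hp) hpd (h p hp)

lemma nearSeg_of_interval (M : IsFoldedMetric Ω d K) {x y : ℂ} (hxi : x.im = 0) (hyi : y.im = 0)
    (h : ∀ r ∈ uIcc x.re y.re, (r : ℂ) ∈ Ω) : NearSeg Ω d x y K := by
  intro A hA hAi w hw
  have hwΩ := M.seg_subset hA hw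
  obtain ⟨u, hu, hui, hur⟩ := M.nearReal_of_opposite hwΩ (M.conj_mem w hwΩ) (hAi w hw)
    (by simpa using hAi w hw)
  exact ⟨u, hu, hui, hur.trans
    (M.conj_near x hA.1 y hA.2.1 hxi hyi h w hwΩ (hAi w hw) (M.seg_add hA hw))⟩

/-- Every geodesic triangle with vertices `x`, `y`, `z` has its side from `x` to `y` in the
`δ`-neighbourhood of the other two. -/
def ThinTri (Ω : Set ℂ) (d : ℂ → ℂ → ℝ) (δ : ℝ) (x y z : ℂ) : Prop :=
  ∀ A B C, GeodSeg Ω d A x y → GeodSeg Ω d B x z → GeodSeg Ω d C z y →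
    ∀ w ∈ A, ∃ p ∈ B ∪ C, d w p ≤ δ

lemma seg_nearReal_of_thin_bigons (M : IsFoldedMetric Ω d K) {c : ℝ}
    (hc : ∀ x y A B, x.im = 0 → y.im = 0 → GeodSeg Ω d A x y → GeodSeg Ω d B x y →
      ∀ w ∈ A, ∃ p ∈ B, d w p ≤ c)
    {A : Set ℂ} {x y : ℂ} (hA : GeodSeg Ω d A x y) (hxi : x.im = 0) (hyi : y.im = 0) :
    ∀ w ∈ A, NearReal Ω d w c := by
  intro w hw
  have hwΩ := M.seg_subset hA hw
  refine M.nearReal_of_fold hwΩ ?_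
  have hF := M.seg_fold hA hxi.ge hyi.ge
  have hG := M.seg_conj hF
  rw [Complex.conj_eq_iff_im.2 hxi, Complex.conj_eq_iff_im.2 hyi] at hG
  obtain ⟨p, hp, hpd⟩ := hc x y _ _ hxi hyi hF hG _ (mem_image_of_mem _ hw)
  have hpΩ := M.seg_subset hG hp
  obtain ⟨_, ⟨q, -, rfl⟩, rfl⟩ := hp
  obtain ⟨u, hu, hui, hur⟩ := M.nearReal_of_opposite (M.fold_mem hwΩ) hpΩ (foldUp_im_nonneg w)
    (by simpa using foldUp_im_nonneg q)
  exact ⟨u, hu, hui, hur.trans hpd⟩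

lemma dist_foldUp_le_of_thin_bigons (M : IsFoldedMetric Ω d K) {c : ℝ} (hc0 : 0 ≤ c)
    (hc : ∀ x y A B, x.im = 0 → y.im = 0 → GeodSeg Ω d A x y → GeodSeg Ω d B x y →
      ∀ w ∈ A, ∃ p ∈ B, d w p ≤ c)
    {A : Set ℂ} {x y : ℂ} (hA : GeodSeg Ω d A x y) (hxi : 0 ≤ x.im) (hyi : 0 ≤ y.im) :
    ∀ w ∈ A, d w (foldUp w) ≤ 2 * c := by
  intro w hw
  have hwΩ := M.seg_subset hA hw
  rcases le_or_gt 0 w.im with hwi | hwi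
  · rw [foldUp_of_nonneg hwi, M.dist_self w hwΩ]; positivity
  refine M.dist_foldUp_le hwΩ ?_
  obtain ⟨hx, hy, g, hg, rfl⟩ := hA
  obtain ⟨t, ht, rfl⟩ := hw
  have hcont := M.continuousOn_im x hx y hy g hg
  obtain ⟨a, ha, hai⟩ := intermediate_value_Icc' ht.1
    (hcont.mono (Icc_subset_Icc le_rfl ht.2)) ⟨hwi.le, by simpa [hg.1] using hxi⟩
  obtain ⟨b, hb, hbi⟩ := intermediate_value_Icc ht.2
    (hcont.mono (Icc_subset_Icc ht.1 le_rfl)) ⟨hwi.le, by simpa [hg.2.1] using hyi⟩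
  exact M.seg_nearReal_of_thin_bigons hc (M.seg_sub hg ha.1 (ha.2.trans hb.1) hb.2) hai hbi _
    ⟨t, ⟨ha.2, hb.1⟩, rfl⟩

lemma thinTri_upper (M : IsFoldedMetric Ω d K) {c : ℝ} (hc0 : 0 ≤ c)
    (hc : ∀ x y A B, x.im = 0 → y.im = 0 → GeodSeg Ω d A x y → GeodSeg Ω d B x y →
      ∀ w ∈ A, ∃ p ∈ B, d w p ≤ c)
    {x y z : ℂ} (hxi : 0 ≤ x.im) (hyi : 0 ≤ y.im) (hzi : 0 ≤ z.im) :
    ThinTri Ω d (2 * K + 4 * c) x y z := by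
  intro A B C hA hB hC w hw
  have hi : ∀ (S : Set ℂ), ∀ p ∈ foldUp '' S, 0 ≤ p.im := by
    rintro S _ ⟨p, -, rfl⟩
    exact foldUp_im_nonneg p
  obtain ⟨q, hq, hqd⟩ := M.thin_upper (M.seg_fold hA hxi hyi) (M.seg_fold hB hxi hzi)
    (M.seg_fold hC hzi hyi) (hi A) (hi B) (hi C) (mem_image_of_mem _ hw)
  obtain ⟨p, hp, rfl⟩ : ∃ p ∈ B ∪ C, foldUp p = q := by
    rwa [← image_union] at hq
  have hwΩ := M.seg_subset hA hw
  have hpΩ : p ∈ Ω := hp.elim (fun h => M.seg_subset hB h) (fun h => M.seg_subset hC h)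
  have h1 := M.dist_foldUp_le_of_thin_bigons hc0 hc hA hxi hyi w hw
  have h2 : d p (foldUp p) ≤ 2 * c := hp.elim
    (fun h => M.dist_foldUp_le_of_thin_bigons hc0 hc hB hxi hzi p h)
    (fun h => M.dist_foldUp_le_of_thin_bigons hc0 hc hC hzi hyi p h)
  rw [M.symm _ hpΩ _ (M.fold_mem hpΩ)] at h2
  have h3 := M.triangle _ hwΩ _ (M.fold_mem hwΩ) _ hpΩ
  have h4 := M.triangle _ (M.fold_mem hwΩ) _ (M.fold_mem hpΩ) _ hpΩ
  exact ⟨p, hp, by linarith⟩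

lemma thinTri_lower (M : IsFoldedMetric Ω d K) {c : ℝ} (hc0 : 0 ≤ c)
    (hc : ∀ x y A B, x.im = 0 → y.im = 0 → GeodSeg Ω d A x y → GeodSeg Ω d B x y →
      ∀ w ∈ A, ∃ p ∈ B, d w p ≤ c)
    {x y z : ℂ} (hxi : x.im ≤ 0) (hyi : y.im ≤ 0) (hzi : z.im ≤ 0) :
    ThinTri Ω d (2 * K + 4 * c) x y z := by
  intro A B C hA hB hC w hw
  obtain ⟨q, hq, hqd⟩ := M.thinTri_upper hc0 hc (by simpa) (by simpa) (by simpa) _ _ _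
    (M.seg_conj hA) (M.seg_conj hB) (M.seg_conj hC) _ (mem_image_of_mem _ hw)
  obtain ⟨p, hp, rfl⟩ : ∃ p ∈ B ∪ C, conj p = q := by
    rwa [← image_union] at hq
  have hpΩ : p ∈ Ω := hp.elim (fun h => M.seg_subset hB h) (fun h => M.seg_subset hC h)
  exact ⟨p, hp, by rwa [M.conj_eq (M.seg_subset hA hw) hpΩ] at hqd⟩

end IsFoldedMetric

lemma bddBelow_dist (Ω : Set ℂ) {d : ℂ → ℂ → ℝ} {z : ℂ} {A : Set ℂ} (hA : A ⊆ Ω)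
    (h : ∀ a ∈ Ω, 0 ≤ d z a) : BddBelow (d z '' A) :=
  ⟨0, by rintro _ ⟨a, ha, rfl⟩; exact h a (hA ha)⟩

namespace IsFoldedMetric

variable {Ω : Set ℂ} {d : ℂ → ℂ → ℝ} {K : ℝ}

lemma distToSet_le (M : IsFoldedMetric Ω d K) {z p : ℂ} {A : Set ℂ} (hA : A ⊆ Ω) (hz : z ∈ Ω)
    (hp : p ∈ A) : distToSet d z A ≤ d z p :=
  csInf_le (bddBelow_dist Ω hA fun _ ha => M.dist_nonneg hz ha) (mem_image_of_mem _ hp)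

lemma exists_of_distToSet_lt {z : ℂ} {A : Set ℂ} {r : ℝ} (hA : A.Nonempty)
    (h : distToSet d z A < r) : ∃ p ∈ A, d z p < r := by
  obtain ⟨_, ⟨p, hp, rfl⟩, hpr⟩ := exists_lt_of_csInf_lt (hA.image _) h
  exact ⟨p, hp, hpr⟩

lemma distToSet_le_add (M : IsFoldedMetric Ω d K) {z w : ℂ} {A : Set ℂ} (hA : A ⊆ Ω)
    (hne : A.Nonempty) (hz : z ∈ Ω) (hw : w ∈ Ω) :
    distToSet d z A ≤ d z w + distToSet d w A := by
  rw [← sub_le_iff_le_add']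
  refine le_csInf (hne.image _) ?_
  rintro _ ⟨p, hp, rfl⟩
  linarith [M.distToSet_le hA hz hp, M.triangle z hz w hw p (hA hp)]

lemma continuousOn_distToSet (M : IsFoldedMetric Ω d K) {x y : ℂ} {g : ℝ → ℂ}
    (hg : IsGeodesicIn Ω d g x y) {A : Set ℂ} (hA : A ⊆ Ω) (hne : A.Nonempty) :
    ContinuousOn (fun t => distToSet d (g t) A) (Icc 0 (d x y)) := by
  have : LipschitzOnWith 1 (fun t => distToSet d (g t) A) (Icc 0 (d x y)) := by
    refine LipschitzOnWith.of_le_add fun s hs t ht => ?_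
    have := M.distToSet_le_add hA hne (hg.2.2.1 s hs) (hg.2.2.1 t ht)
    rw [hg.2.2.2 s hs t ht] at this
    rw [Real.dist_eq]
    linarith
  exact this.continuousOn

/-- A point on a geodesic segment which passes from the neighbourhood of `A₁` to that of `A₂`
is close either to `O`, or to both `A₁` and `A₂`. -/
lemma exists_near_both (M : IsFoldedMetric Ω d K) {E A₁ A₂ O : Set ℂ} {u v : ℂ} {r s : ℝ}
    (hE : GeodSeg Ω d E u v) (h₁ : A₁ ⊆ Ω) (h₂ : A₂ ⊆ Ω) (hO : O ⊆ Ω) (hu₁ : u ∈ A₁) (hu₂ : u ∈ A₂)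
    (hne : O.Nonempty) (hr : 0 ≤ r) (hv : ∃ p ∈ O, d v p ≤ s)
    (h : ∀ w ∈ E, (∃ p ∈ A₁ , d w p ≤ r) ∧ (∃ p ∈ A₂, d w p ≤ r) ∨ ∃ p ∈ O, d w p ≤ s) :
    ∃ w ∈ E, (∃ p ∈ A₁, d w p < r + 1) ∧ (∃ p ∈ A₂, d w p < r + 1) ∧ ∃ p ∈ O, d w p < s + 1 := by
  obtain ⟨hu, hv', g, hg, rfl⟩ := hE
  have h0 := M.dist_nonneg hu hv'
  have c1 := M.continuousOn_distToSet hg h₁ ⟨u, hu₁⟩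
  have c2 := M.continuousOn_distToSet hg h₂ ⟨u, hu₂⟩
  have c3 := M.continuousOn_distToSet hg hO hne
  have k1 := ContinuousOn.preimage_isClosed_of_isClosed (ContinuousOn.sup c1 c2)
    isClosed_Icc (isClosed_Iic (a := r))
  have k2 := ContinuousOn.preimage_isClosed_of_isClosed c3 isClosed_Icc (isClosed_Iic (a := s))
  have hpc := isPreconnected_closed_iff.1 (isPreconnected_Icc (a := (0:ℝ)) (b := d u v)) _ _ k1 k2
  have le_of : ∀ {A : Set ℂ} {q : ℝ} {t : ℝ}, t ∈ Icc 0 (d u v) → A ⊆ Ω →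
      (∃ p ∈ A, d (g t) p ≤ q) → distToSet d (g t) A ≤ q := by
    rintro A q t ht hA ⟨p, hp, hpq⟩
    exact (M.distToSet_le hA (hg.2.2.1 t ht) hp).trans hpq
  have q1 := hpc (by
    intro t ht
    rcases h (g t) ⟨t, ht, rfl⟩ with ⟨h1, h2⟩ | h3
    · exact Or.inl ⟨ht, max_le (le_of ht h₁ h1) (le_of ht h₂ h2)⟩
    · exact Or.inr ⟨ht, le_of ht hO h3⟩)
  have q2 := q1 (by
    refine ⟨0, ⟨le_rfl, h0⟩, ⟨le_rfl, h0⟩, mem_preimage.2 (mem_Iic.2 (max_le ?_ ?_))⟩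
    · exact le_of ⟨le_rfl, h0⟩ h₁ ⟨u, hu₁, by rw [hg.1, M.dist_self u hu]; exact hr⟩
    · exact le_of ⟨le_rfl, h0⟩ h₂ ⟨u, hu₂, by rw [hg.1, M.dist_self u hu]; exact hr⟩)
  obtain ⟨t, ht, ht1, ht2⟩ := q2
    ⟨d u v, ⟨h0, le_rfl⟩, ⟨h0, le_rfl⟩, le_of ⟨h0, le_rfl⟩ hO (by rwa [hg.2.1])⟩
  refine ⟨g t, ⟨t, ht, rfl⟩, exists_of_distToSet_lt ⟨u, hu₁⟩ ?_,
    exists_of_distToSet_lt ⟨u, hu₂⟩ ?_, exists_of_distToSet_lt hne ?_⟩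
  · have : max (distToSet d (g t) A₁) (distToSet d (g t) A₂) ≤ r := ht1.2
    linarith [le_max_left (distToSet d (g t) A₁) (distToSet d (g t) A₂)]
  · have : max (distToSet d (g t) A₁) (distToSet d (g t) A₂) ≤ r := ht1.2
    linarith [le_max_right (distToSet d (g t) A₁) (distToSet d (g t) A₂)]
  · have : distToSet d (g t) O ≤ s := ht2.2
    linarith

lemma thin_of_crossing (M : IsFoldedMetric Ω d K) {S T : Set ℂ} {δ : ℝ} (hδ : 0 ≤ δ)
    (hS : ∀ x ∈ S, ∀ y ∈ S, ∀ z ∈ S, ThinTri Ω d δ x y z)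
    (hT : ∀ x ∈ T, ∀ y ∈ T, ∀ z ∈ T, ThinTri Ω d δ x y z)
    {A B C : Set ℂ} {x y z u v : ℂ}
    (hA : GeodSeg Ω d A x y) (hB : GeodSeg Ω d B x z) (hC : GeodSeg Ω d C z y)
    (hx : x ∈ S) (hz : z ∈ S) (hy : y ∈ T) (huA : u ∈ A) (hvC : v ∈ C) (hu : u ∈ S ∩ T)
    (hv : v ∈ S ∩ T) :
    (∀ w ∈ B, ∃ p ∈ A ∪ C, d w p ≤ 3 * δ) ∧ ∀ w ∈ A, ∃ p ∈ B ∪ C, d w p ≤ 7 * δ + 3 := by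
  obtain ⟨A₁, A₂, hA₁, hA₂, rfl, hadd⟩ := M.seg_split hA huA
  obtain ⟨C₁, C₂, hC₁, hC₂, rfl, -⟩ := M.seg_split hC hvC
  obtain ⟨E, hE⟩ := M.exists_seg hA₁.2.1 hC₁.2.1
  obtain ⟨D, hD⟩ := M.exists_seg hA.1 hC₁.2.1
  have eA₁ := M.seg_subset hA₁
  have eA₂ := M.seg_subset hA₂
  have eB := M.seg_subset hB
  have eC₁ := M.seg_subset hC₁
  have eC₂ := M.seg_subset hC₂
  have eE := M.seg_subset hE
  have eD := M.seg_subset hD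
  have D_EA : ∀ w ∈ D, ∃ p ∈ A₁ ∪ E, d w p ≤ δ :=
    hS _ hx _ hv.1 _ hu.1 _ _ _ hD hA₁ hE
  have D_BC : ∀ w ∈ D, ∃ p ∈ B ∪ C₁, d w p ≤ δ :=
    hS _ hx _ hv.1 _ hz _ _ _ hD hB hC₁
  have B_DC : ∀ w ∈ B, ∃ p ∈ D ∪ C₁, d w p ≤ δ :=
    hS _ hx _ hz _ hv.1 _ _ _ hB hD (M.seg_symm hC₁)
  have E_AC : ∀ w ∈ E, ∃ p ∈ A₂ ∪ C₂, d w p ≤ δ :=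
    hT _ hu.2 _ hv.2 _ hy _ _ _ hE hA₂ (M.seg_symm hC₂)
  have E_AD : ∀ w ∈ E, ∃ p ∈ A₁ ∪ D, d w p ≤ δ :=
    hS _ hu.1 _ hv.1 _ hx _ _ _ hE (M.seg_symm hA₁) hD
  have A₁_DE : ∀ w ∈ A₁, ∃ p ∈ D ∪ E, d w p ≤ δ :=
    hS _ hx _ hu.1 _ hv.1 _ _ _ hA₁ hD (M.seg_symm hE)
  have A₂_EC : ∀ w ∈ A₂, ∃ p ∈ E ∪ C₂, d w p ≤ δ :=
    hT _ hu.2 _ hy _ hv.2 _ _ _ hA₂ hE hC₂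
  refine ⟨fun w hw => ?_, ?_⟩
  · obtain ⟨p, hp | hp, hwp⟩ := B_DC w hw
    · obtain ⟨q, hq | hq, hpq⟩ := D_EA p hp
      · exact ⟨q, Or.inl (Or.inl hq), by
          linarith [M.triangle w (eB hw) p (eD hp) q (eA₁ hq)]⟩
      · obtain ⟨r, hr | hr, hqr⟩ := E_AC q hq
        · exact ⟨r, Or.inl (Or.inr hr), by
            linarith [M.triangle w (eB hw) p (eD hp) q (eE hq),
              M.triangle w (eB hw) q (eE hq) r (eA₂ hr)]⟩
        · exact ⟨r, Or.inr (Or.inr hr), by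
            linarith [M.triangle w (eB hw) p (eD hp) q (eE hq),
              M.triangle w (eB hw) q (eE hq) r (eC₂ hr)]⟩
    · exact ⟨p, Or.inr (Or.inl hp), by linarith⟩
  have eO : B ∪ (C₁ ∪ C₂) ⊆ Ω := union_subset eB (union_subset eC₁ eC₂)
  have near_u : ∀ w ∈ Ω, ∀ p ∈ A₁, ∀ q ∈ A₂, ∀ r, d w p ≤ r → d w q ≤ r → d w u ≤ 2 * r := by
    intro w hw p hp q hq r hwp hwq
    have h1 := M.triangle p (eA₁ hp) w hw q (eA₂ hq)
    rw [M.symm p (eA₁ hp) w hw, hadd p hp q hq] at h1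
    have h2 := M.triangle w hw p (eA₁ hp) u hA₁.2.1
    have h3 := M.triangle w hw q (eA₂ hq) u hA₁.2.1
    rw [M.symm q (eA₂ hq) u hA₁.2.1] at h3
    linarith
  have D_O : ∀ w ∈ D, ∃ p ∈ B ∪ (C₁ ∪ C₂), d w p ≤ δ := by
    intro w hw
    obtain ⟨p, hp | hp, hwp⟩ := D_BC w hw
    · exact ⟨p, Or.inl hp, hwp⟩
    · exact ⟨p, Or.inr (Or.inl hp), hwp⟩
  have dich : ∀ w ∈ E, (∃ p ∈ A₁, d w p ≤ δ) ∧ (∃ p ∈ A₂, d w p ≤ δ) ∨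
      ∃ p ∈ B ∪ (C₁ ∪ C₂), d w p ≤ 2 * δ := by
    intro w hw
    obtain ⟨p, hp | hp, hwp⟩ := E_AC w hw
    · obtain ⟨q, hq | hq, hwq⟩ := E_AD w hw
      · exact Or.inl ⟨⟨q, hq, hwq⟩, ⟨p, hp, hwp⟩⟩
      · obtain ⟨r, hr, hqr⟩ := D_O q hq
        exact Or.inr ⟨r, hr, by linarith [M.triangle w (eE hw) q (eD hq) r (eO hr)]⟩
    · exact Or.inr ⟨p, Or.inr (Or.inr hp), by linarith⟩
  have hvO : v ∈ B ∪ (C₁ ∪ C₂) := Or.inr (Or.inl (M.right_mem hC₁))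
  obtain ⟨q, hq, huq⟩ : ∃ q ∈ B ∪ (C₁ ∪ C₂), d u q ≤ 4 * δ + 3 := by
    obtain ⟨w, hw, ⟨p, hp, hwp⟩, ⟨q, hq, hwq⟩, r, hr, hwr⟩ := M.exists_near_both hE eA₁ eA₂ eO
      (M.right_mem hA₁) (M.left_mem hA₂) ⟨v, hvO⟩ hδ
      ⟨v, hvO, by rw [M.dist_self v hC₁.2.1]; positivity⟩ dich
    have h1 := near_u w (eE hw) p hp q hq _ hwp.le hwq.le
    rw [M.symm w (eE hw) u hA₁.2.1] at h1
    exact ⟨r, hr, by linarith [M.triangle u hA₁.2.1 w (eE hw) r (eO hr)]⟩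
  have fin : ∀ w ∈ Ω, ∀ e ∈ E, d w e ≤ δ → ∃ p ∈ B ∪ (C₁ ∪ C₂), d w p ≤ 7 * δ + 3 := by
    intro w hw e he hwe
    rcases dich e he with ⟨⟨p, hp, hep⟩, ⟨r, hr, her⟩⟩ | ⟨p, hp, hep⟩
    · have h1 := near_u e (eE he) p hp r hr _ hep her
      exact ⟨q, hq, by
        linarith [M.triangle w hw e (eE he) u hA₁.2.1, M.triangle w hw u hA₁.2.1 q (eO hq)]⟩
    · exact ⟨p, hp, by linarith [M.triangle w hw e (eE he) p (eO hp)]⟩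
  rintro w (hw | hw)
  · obtain ⟨p, hp | hp, hwp⟩ := A₁_DE w hw
    · obtain ⟨r, hr, hpr⟩ := D_O p hp
      exact ⟨r, hr, by linarith [M.triangle w (eA₁ hw) p (eD hp) r (eO hr)]⟩
    · exact fin w (eA₁ hw) p hp hwp
  · obtain ⟨p, hp | hp, hwp⟩ := A₂_EC w hw
    · exact fin w (eA₂ hw) p hp hwp
    · exact ⟨p, Or.inr (Or.inr hp), by linarith⟩

lemma thinTri_of_crossing (M : IsFoldedMetric Ω d K) {S T : Set ℂ} {δ : ℝ} (hδ : 0 ≤ δ)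
    (hS : ∀ x ∈ S, ∀ y ∈ S, ∀ z ∈ S, ThinTri Ω d δ x y z)
    (hT : ∀ x ∈ T, ∀ y ∈ T, ∀ z ∈ T, ThinTri Ω d δ x y z)
    (hcross : ∀ A x y, GeodSeg Ω d A x y → x ∈ S → y ∈ T → ∃ u ∈ A, u ∈ S ∩ T)
    {x y z : ℂ} (hx : x ∈ S) (hz : z ∈ S) (hy : y ∈ T) :
    ThinTri Ω d (7 * δ + 3) x y z ∧ ThinTri Ω d (7 * δ + 3) y x z ∧
      ThinTri Ω d (7 * δ + 3) x z y := by
  refine ⟨fun A B C hA hB hC w hw => ?_, fun A B C hA hB hC w hw => ?_,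
    fun A B C hA hB hC w hw => ?_⟩
  · obtain ⟨u, huA, hu⟩ := hcross A x y hA hx hy
    obtain ⟨v, hvC, hv⟩ := hcross C z y hC hz hy
    exact (M.thin_of_crossing hδ hS hT hA hB hC hx hz hy huA hvC hu hv).2 w hw
  · replace hA := M.seg_symm hA
    replace hB := M.seg_symm hB
    replace hC := M.seg_symm hC
    obtain ⟨u, huA, hu⟩ := hcross A x y hA hx hy
    obtain ⟨v, hvB, hv⟩ := hcross B z y hB hz hy
    rw [union_comm]
    exact (M.thin_of_crossing hδ hS hT hA hC hB hx hz hy huA hvB hu hv).2 w hw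
  · replace hC := M.seg_symm hC
    obtain ⟨u, huB, hu⟩ := hcross B x y hB hx hy
    obtain ⟨v, hvC, hv⟩ := hcross C z y hC hz hy
    obtain ⟨p, hp, hwp⟩ := (M.thin_of_crossing hδ hS hT hB hA hC hx hz hy huB hvC hu hv).1 w hw
    exact ⟨p, hp, by linarith⟩

lemma thinTri_of_thin_bigons (M : IsFoldedMetric Ω d K) {c : ℝ} (hc0 : 0 ≤ c)
    (hc : ∀ x y A B, x.im = 0 → y.im = 0 → GeodSeg Ω d A x y → GeodSeg Ω d B x y →
      ∀ w ∈ A, ∃ p ∈ B, d w p ≤ c) (x y z : ℂ) :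
    ThinTri Ω d (7 * (2 * K + 4 * c) + 3) x y z := by
  have hK := M.const_nonneg
  set δ := 2 * K + 4 * c with hδd
  have hδ : 0 ≤ δ := by positivity
  let S : Set ℂ := {z | 0 ≤ z.im}
  let T : Set ℂ := {z | z.im ≤ 0}
  have hS : ∀ x ∈ S, ∀ y ∈ S, ∀ z ∈ S, ThinTri Ω d δ x y z :=
    fun x hx y hy z hz => M.thinTri_upper hc0 hc hx hy hz
  have hT : ∀ x ∈ T, ∀ y ∈ T, ∀ z ∈ T, ThinTri Ω d δ x y z :=
    fun x hx y hy z hz => M.thinTri_lower hc0 hc hx hy hz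
  have cST : ∀ A x y, GeodSeg Ω d A x y → x ∈ S → y ∈ T → ∃ u ∈ A, u ∈ S ∩ T := by
    intro A x y hA hx hy
    obtain ⟨u, hu, hui⟩ := M.seg_exists_real hA hx hy
    exact ⟨u, hu, hui.ge, hui.le⟩
  have cTS : ∀ A x y, GeodSeg Ω d A x y → x ∈ T → y ∈ S → ∃ u ∈ A, u ∈ T ∩ S := by
    intro A x y hA hx hy
    obtain ⟨u, hu, hui⟩ := M.seg_exists_real (M.seg_symm hA) hy hx
    exact ⟨u, hu, hui.le, hui.ge⟩
  have mono : ∀ {x y z : ℂ}, ThinTri Ω d δ x y z → ThinTri Ω d (7 * δ + 3) x y z := by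
    intro x y z h A B C hA hB hC w hw
    obtain ⟨p, hp, hwp⟩ := h A B C hA hB hC w hw
    exact ⟨p, hp, by linarith⟩
  rcases le_total 0 x.im with hx | hx <;> rcases le_total 0 y.im with hy | hy <;>
    rcases le_total 0 z.im with hz | hz
  · exact mono (hS x hx y hy z hz)
  · exact (M.thinTri_of_crossing hδ hS hT cST hx hy hz).2.2
  · exact (M.thinTri_of_crossing hδ hS hT cST hx hz hy).1
  · exact (M.thinTri_of_crossing hδ hT hS cTS hy hz hx).2.1
  · exact (M.thinTri_of_crossing hδ hS hT cST hy hz hx).2.1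
  · exact (M.thinTri_of_crossing hδ hT hS cTS hx hz hy).1
  · exact (M.thinTri_of_crossing hδ hT hS cTS hx hy hz).2.2
  · exact mono (hT x hx y hy z hz)

end IsFoldedMetric

namespace IsFoldedMetric

variable {Ω : Set ℂ} {d : ℂ → ℂ → ℝ} {K : ℝ} {I : ℕ → Set ℝ}

lemma distToSet_real_le (M : IsFoldedMetric Ω d K) {z : ℂ} {r : ℝ} (hz : z ∈ Ω)
    (h : NearReal Ω d z r) : distToSet d z (Ω ∩ realLine) ≤ r := by
  obtain ⟨u, hu, hui, hur⟩ := h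
  exact (M.distToSet_le inter_subset_left hz ⟨hu, hui⟩).trans hur

lemma nearReal_of_distToSet {z u : ℂ} {c : ℝ} (hu : u ∈ Ω) (hui : u.im = 0)
    (h : distToSet d z (Ω ∩ realLine) ≤ c) : NearReal Ω d z (|c| + 1) := by
  obtain ⟨p, hp, hpd⟩ := exists_of_distToSet_lt
    (A := Ω ∩ realLine) (r := |c| + 1) ⟨u, hu, hui⟩
    (by linarith [le_abs_self c])
  exact ⟨p, hp.1, hp.2, hpd.le⟩

lemma condAllFund_of_gromovHyperbolic (M : IsFoldedMetric Ω d K) {δ : ℝ}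
    (h : GromovHyperbolicWith Ω d δ) : DenjoyCondAllFund Ω d I δ := by
  rintro n - g x y ⟨hg, hxi, -, hyi, -, hgi⟩ z hz
  have h0 : (0:ℝ) ≤ d x y := by
    obtain ⟨t, ht, -⟩ := hz
    exact ht.1.trans ht.2
  have hx : x ∈ Ω := by
    have := hg.2.2.1 0 ⟨le_rfl, h0⟩
    rwa [hg.1] at this
  have hy : y ∈ Ω := by
    have := hg.2.2.1 _ ⟨h0, le_rfl⟩
    rwa [hg.2.1] at this
  have hseg : GeodSeg Ω d (g '' Icc 0 (d x y)) x y := ⟨hx, hy, g, hg, rfl⟩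
  have hzΩ := M.seg_subset hseg hz
  have hconj := M.seg_conj hseg
  rw [Complex.conj_eq_iff_im.2 hxi, Complex.conj_eq_iff_im.2 hyi] at hconj
  obtain ⟨-, -, g', hg', hgg'⟩ := id hconj
  have hyy := M.dist_self y hy
  have hconst : IsGeodesicIn Ω d (fun _ => y) y y := by
    refine ⟨rfl, rfl, fun _ _ => hy, fun s hs t ht => ?_⟩
    rw [hyy] at hs ht
    simp [hyy, le_antisymm hs.2 hs.1, le_antisymm ht.2 ht.1]
  obtain ⟨t, ht, rfl⟩ := hz
  obtain ⟨p, hp, hpd⟩ := h x hx y hy y hy g g' _ hg hg' hconst t ht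
  rw [← hgg'] at hp
  have hpi : p ∈ conj '' (g '' Icc 0 (d x y)) := by
    rcases hp with hp | ⟨_, _, rfl⟩
    · exact hp
    · exact M.right_mem hconj
  have hpΩ := M.seg_subset hconj hpi
  have hpim : p.im ≤ 0 := by
    obtain ⟨_, ⟨s, hs, rfl⟩, rfl⟩ := hpi
    simpa using hgi s hs
  exact (M.distToSet_real_le hzΩ (M.nearReal_of_opposite hzΩ hpΩ (hgi t ht) hpim)).trans hpd

lemma condSomeFund_of_condAllFund (M : IsFoldedMetric Ω d K) (hne : ∀ n, (I n).Nonempty)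
    (hI : (fun x : ℝ => (x : ℂ)) ⁻¹' Ω = ⋃ n, I n) {c : ℝ} (h : DenjoyCondAllFund Ω d I c) :
    DenjoyCondSomeFund Ω d I c := by
  choose r hr using hne
  have hrΩ : ∀ n, ((r n : ℝ) : ℂ) ∈ Ω := fun n =>
    (Set.ext_iff.1 hI (r n)).2 (mem_iUnion.2 ⟨n, hr n⟩)
  have : ∀ n, ∃ g : ℝ → ℂ, IsFundGeodesic Ω d (I 0) (I n) g (r 0 : ℝ) (r n : ℝ) := by
    intro n
    obtain ⟨A, ⟨-, -, g, hg, rfl⟩, hA⟩ := M.exists_seg_upper (hrΩ 0) (hrΩ n) (by simp) (by simp)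
    exact ⟨g, hg, by simp, by simpa using hr 0, by simp, by simpa using hr n,
      fun t ht => hA _ ⟨t, ht, rfl⟩⟩
  choose g hg using this
  exact ⟨g, fun _ => (r 0 : ℝ), fun n => (r n : ℝ), fun n _ => hg n,
    fun n hn => h n hn (g n) _ _ (hg n)⟩

lemma nearSeg_of_condSomeFund (M : IsFoldedMetric Ω d K) (hord : ∀ n, (I n).OrdConnected)
    (hI : (fun x : ℝ => (x : ℂ)) ⁻¹' Ω = ⋃ n, I n) {c : ℝ} (h : DenjoyCondSomeFund Ω d I c)
    {x y : ℂ} (hx : x ∈ Ω) (hy : y ∈ Ω) (hxi : x.im = 0) (hyi : y.im = 0) :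
    NearSeg Ω d x y (11 * K + |c| + 1) := by
  have hK := M.const_nonneg
  have hc := abs_nonneg c
  have mono : ∀ {x y : ℂ} {r s : ℝ}, r ≤ s → NearSeg Ω d x y r → NearSeg Ω d x y s := by
    intro x y r s hrs h A hA hAi w hw
    obtain ⟨u, hu, hui, hur⟩ := h A hA hAi w hw
    exact ⟨u, hu, hui, hur.trans hrs⟩
  have trans : ∀ {x y z : ℂ} {r : ℝ}, z ∈ Ω → z.im = 0 → NearSeg Ω d x z r → NearSeg Ω d z y r →
      NearSeg Ω d x y (2 * K + r) := by
    intro x y z r hz hzi hxz hzy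
    simpa using M.nearSeg_trans hz hzi.ge hxz hzy
  have mem_of : ∀ n, ∀ r ∈ I n, (r : ℂ) ∈ Ω := fun n r hr =>
    (Set.ext_iff.1 hI r).2 (mem_iUnion.2 ⟨n, hr⟩)
  have mem_of' : ∀ n, ∀ z : ℂ, z.im = 0 → z.re ∈ I n → z ∈ Ω := by
    intro n z hz hzn
    have := mem_of n _ hzn
    rwa [show ((z.re : ℝ) : ℂ) = z from Complex.ext rfl (by simp [hz])] at this
  have interval : ∀ n, ∀ z w : ℂ, z.im = 0 → w.im = 0 → z.re ∈ I n → w.re ∈ I n →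
      NearSeg Ω d z w K := fun n z w hz hw hzn hwn =>
    M.nearSeg_of_interval hz hw fun r hr => mem_of n r ((hord n).uIcc_subset hzn hwn hr)
  obtain ⟨g, a, b, hg, hgc⟩ := h
  have base : ∀ z ∈ Ω, z.im = 0 → ∃ p ∈ Ω, p.im = 0 ∧ p.re ∈ I 0 ∧
      NearSeg Ω d z p (5 * K + |c| + 1) := by
    intro z hz hzi
    obtain ⟨n, hn⟩ : ∃ n, z.re ∈ I n := by
      refine mem_iUnion.1 (hI ▸ ?_ : z.re ∈ ⋃ n, I n)
      change ((z.re : ℝ) : ℂ) ∈ Ω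
      rwa [show ((z.re : ℝ) : ℂ) = z from Complex.ext rfl (by simp [hzi])]
    rcases Nat.eq_zero_or_pos n with rfl | hpos
    · exact ⟨z, hz, hzi, hn, mono (by linarith) (interval 0 z z hzi hzi hn hn)⟩
    obtain ⟨hgn, hai, ha, hbi, hb, hgi⟩ := hg n hpos
    have haΩ := mem_of' 0 _ hai ha
    have hbΩ := mem_of' n _ hbi hb
    refine ⟨a n, haΩ, hai, ha, ?_⟩
    have h1 := interval n z (b n) hzi hbi hn hb
    have hseg : GeodSeg Ω d (g n '' Icc 0 (d (a n) (b n))) (a n) (b n) :=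
      ⟨haΩ, hbΩ, g n, hgn, rfl⟩
    have h2 := M.nearSeg_symm (M.nearSeg_of_seg hseg (by rintro _ ⟨t, ht, rfl⟩; exact hgi t ht)
      fun w hw => nearReal_of_distToSet haΩ hai (hgc n hpos w hw))
    exact mono (by linarith) (trans (r := 2 * K + (|c| + 1)) hbΩ hbi (mono (by linarith) h1) h2)
  obtain ⟨p, hp, hpi, hpI, hxp⟩ := base x hx hxi
  obtain ⟨q, hq, hqi, hqI, hyq⟩ := base y hy hyi
  have h1 := trans hp hpi hxp (mono (by linarith) (interval 0 p q hpi hqi hpI hqI))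
  exact mono (by linarith)
    (trans hq hqi h1 (mono (by linarith) (M.nearSeg_symm hyq)))

lemma condBigon_of_condSomeFund (M : IsFoldedMetric Ω d K) (hord : ∀ n, (I n).OrdConnected)
    (hI : (fun x : ℝ => (x : ℂ)) ⁻¹' Ω = ⋃ n, I n) {c : ℝ} (h : DenjoyCondSomeFund Ω d I c) :
    DenjoyCondBigon Ω d (46 * K + 4 * (|c| + 1)) := by
  rintro x ⟨hx, hxi⟩ y ⟨hy, hyi⟩ g₁ g₂ hg₁ hg₂ z hz
  have h₁ : GeodSeg Ω d _ x y := ⟨hx, hy, g₁, hg₁, rfl⟩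
  have h₂ : GeodSeg Ω d _ x y := ⟨hx, hy, g₂, hg₂, rfl⟩
  have hnear := M.nearSeg_of_condSomeFund hord hI h hx hy hxi hyi
  have f₁ := M.seg_fold h₁ (le_of_eq hxi.symm) (le_of_eq hyi.symm)
  have f₂ := M.seg_fold h₂ (le_of_eq hxi.symm) (le_of_eq hyi.symm)
  have hi : ∀ S : Set ℂ, ∀ p ∈ foldUp '' S, 0 ≤ p.im := by
    rintro S _ ⟨p, -, rfl⟩
    exact foldUp_im_nonneg p
  have close : ∀ S, GeodSeg Ω d S x y → GeodSeg Ω d (foldUp '' S) x y → ∀ p ∈ S,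
      d p (foldUp p) ≤ 2 * (11 * K + |c| + 1) := fun S hS hf p hp =>
    M.dist_foldUp_le (M.seg_subset hS hp) (M.nearReal_of_fold (M.seg_subset hS hp)
      (hnear _ hf (hi S) _ (mem_image_of_mem _ hp)))
  have hzΩ := M.seg_subset h₁ hz
  obtain ⟨_, ⟨w, hw, rfl⟩, hwd⟩ := M.exists_near_of_almost_between f₂ (hi _) (M.fold_mem hzΩ)
    (foldUp_im_nonneg z)
    (by linarith [M.seg_add f₁ (mem_image_of_mem _ hz), M.const_nonneg])
  have hwΩ := M.seg_subset h₂ hw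
  have e1 := close _ h₁ f₁ z hz
  have e2 := close _ h₂ f₂ w hw
  rw [M.symm _ hwΩ _ (M.fold_mem hwΩ)] at e2
  refine ⟨w, hw, ?_⟩
  linarith [M.triangle z hzΩ _ (M.fold_mem hzΩ) w hwΩ,
    M.triangle _ (M.fold_mem hzΩ) _ (M.fold_mem hwΩ) w hwΩ]

lemma gromovHyperbolic_of_condBigon (M : IsFoldedMetric Ω d K) (hne : (I 0).Nonempty)
    (hI : (fun x : ℝ => (x : ℂ)) ⁻¹' Ω = ⋃ n, I n) {c : ℝ} (h : DenjoyCondBigon Ω d c) :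
    GromovHyperbolicWith Ω d (7 * (2 * K + 4 * c) + 3) := by
  have hc : ∀ x y A B, x.im = 0 → y.im = 0 → GeodSeg Ω d A x y → GeodSeg Ω d B x y →
      ∀ w ∈ A, ∃ p ∈ B, d w p ≤ c := by
    rintro x y _ _ hxi hyi ⟨hx, hy, g₁, hg₁, rfl⟩ ⟨-, -, g₂, hg₂, rfl⟩
    exact h x ⟨hx, hxi⟩ y ⟨hy, hyi⟩ g₁ g₂ hg₁ hg₂
  have hc0 : 0 ≤ c := by
    obtain ⟨r, hr⟩ := hne
    have hrΩ : (r : ℂ) ∈ Ω := (Set.ext_iff.1 hI r).2 (mem_iUnion.2 ⟨0, hr⟩)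
    obtain ⟨A, hA⟩ := M.exists_seg hrΩ hrΩ
    obtain ⟨p, hp, hpd⟩ := hc _ _ A A (by simp) (by simp) hA hA _ (M.left_mem hA)
    exact (M.dist_nonneg hrΩ (M.seg_subset hA hp)).trans hpd
  intro x hx y hy z hz gxy gxz gzy h1 h2 h3 t ht
  exact M.thinTri_of_thin_bigons hc0 hc x y z _ _ _ ⟨hx, hy, gxy, h1, rfl⟩ ⟨hx, hz, gxz, h2, rfl⟩
    ⟨hz, hy, gzy, h3, rfl⟩ _ ⟨t, ht, rfl⟩

end IsFoldedMetric

end FoldedMetric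

section Covering

open scoped ComplexConjugate Topology

section HalfPlane

open UpperHalfPlane hiding I

lemma add_I_ne_zero {z : ℂ} (hz : 0 < z.im) : z + I ≠ 0 := by
  intro h
  have := congrArg Complex.im h
  simp at this
  linarith

lemma one_sub_normSq_cayley {z : ℂ} (hz : 0 < z.im) :
    1 - ‖(z - I) / (z + I)‖ ^ 2 = 4 * z.im / ‖z + I‖ ^ 2 := by
  have h : ‖z + I‖ ^ 2 ≠ 0 := by simpa using add_I_ne_zero hz
  rw [norm_div, div_pow, eq_div_iff h, sub_mul, div_mul_cancel₀ _ h, one_mul]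
  rw [← Complex.normSq_eq_norm_sq, ← Complex.normSq_eq_norm_sq, Complex.normSq_apply,
    Complex.normSq_apply]
  simp
  ring

/-- The Cayley transform as a homeomorphism of the upper half plane onto the unit disk. -/
def cayleyHomeo : ℍ ≃ₜ ball (0:ℂ) 1 where
  toFun z := ⟨((z:ℂ) - I) / (z + I), by
    have h := one_sub_normSq_cayley z.im_pos
    have h1 : 0 < 4 * (z:ℂ).im / ‖(z:ℂ) + I‖ ^ 2 :=
      div_pos (mul_pos (by norm_num) z.im_pos)
        (pow_pos (norm_pos_iff.2 (add_I_ne_zero z.im_pos)) 2)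
    rw [mem_ball_zero_iff]
    rw [← h] at h1
    nlinarith [norm_nonneg (((z:ℂ) - I) / (z + I))]⟩
  invFun w := ⟨I * (1 + w) / (1 - w), by
    have hw := w.2
    rw [mem_ball_zero_iff] at hw
    have h1 : (1 - (w:ℂ)) ≠ 0 := by
      intro h
      rw [← sub_eq_zero.1 h] at hw
      simp at hw
    have h2 : 0 < Complex.normSq (1 - (w:ℂ)) := Complex.normSq_pos.2 h1
    have h3 : Complex.normSq (w:ℂ) < 1 := by
      rw [Complex.normSq_eq_norm_sq]
      nlinarith [norm_nonneg (w:ℂ)]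
    have h4 : (I * (1 + (w:ℂ)) / (1 - w)).im =
        (1 - Complex.normSq (w:ℂ)) / Complex.normSq (1 - (w:ℂ)) := by
      rw [Complex.div_im]
      simp [Complex.normSq_apply]
      ring
    rw [h4]
    exact div_pos (by linarith) h2⟩
  left_inv z := by
    apply UpperHalfPlane.ext
    have h := add_I_ne_zero z.im_pos
    have h2 : (1:ℂ) - ((z:ℂ) - I) / (z + I) = 2 * I / (z + I) := by
      field_simp; ring
    have h3 : (1:ℂ) + ((z:ℂ) - I) / (z + I) = 2 * z / (z + I) := by
      field_simp; ring
    change I * (1 + ((z:ℂ) - I) / (z + I)) / (1 - ((z:ℂ) - I) / (z + I)) = z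
    rw [h2, h3]
    field_simp
  right_inv w := by
    apply Subtype.ext
    have hw := w.2
    rw [mem_ball_zero_iff] at hw
    have h1 : (1 - (w:ℂ)) ≠ 0 := by
      intro h
      rw [← sub_eq_zero.1 h] at hw
      simp at hw
    have h2 : I * (1 + (w:ℂ)) / (1 - w) - I = 2 * I * w / (1 - w) := by
      field_simp; ring
    have h3 : I * (1 + (w:ℂ)) / (1 - w) + I = 2 * I / (1 - w) := by
      field_simp; ring
    change (I * (1 + (w:ℂ)) / (1 - w) - I) / (I * (1 + (w:ℂ)) / (1 - w) + I) = w
    rw [h2, h3]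
    field_simp
  continuous_toFun := by
    refine Continuous.subtype_mk ?_ _
    exact (UpperHalfPlane.continuous_coe.sub continuous_const).div
      (UpperHalfPlane.continuous_coe.add continuous_const) (fun z => add_I_ne_zero z.im_pos)
  continuous_invFun := by
    rw [UpperHalfPlane.isEmbedding_coe.continuous_iff]
    change Continuous fun w : ball (0:ℂ) 1 => I * (1 + (w:ℂ)) / (1 - w)
    refine (continuous_const.mul (continuous_const.add continuous_subtype_val)).div
      (continuous_const.sub continuous_subtype_val) (fun w h => ?_)
    have hw := w.2
    rw [mem_ball_zero_iff, ← sub_eq_zero.1 h] at hw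
    simp at hw

/-- `Q` is a holomorphic covering of `Ω` by the upper half plane, for which the pullback of the
density `lam` is the Poincaré density. -/
structure IsHalfPlaneCover (Ω : Set ℂ) (lam : ℂ → ℝ) (Q : ℂ → ℂ) : Prop where
  differentiableAt : ∀ z : ℂ, 0 < z.im → DifferentiableAt ℂ Q z
  covering : IsCoveringMapOn (fun z : ℍ => Q z) Ω
  mem : ∀ z : ℍ, Q z ∈ Ω
  surj : ∀ x ∈ Ω, ∃ z : ℍ, Q z = x
  density : ∀ z : ℍ, lam (Q z) * ‖deriv Q z‖ = 1 / z.im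

lemma IsPoincareDensity.exists_halfPlaneCover {Ω : Set ℂ} {lam : ℂ → ℝ}
    (h : IsPoincareDensity Ω lam) : ∃ Q, IsHalfPlaneCover Ω lam Q := by
  obtain ⟨p, hd, himg, hcov, hdens⟩ := h
  have hmem : ∀ z : ℂ, 0 < z.im → (z - I) / (z + I) ∈ ball (0:ℂ) 1 := fun z hz =>
    (cayleyHomeo ⟨z, hz⟩).2
  have hder : ∀ z : ℂ, 0 < z.im →
      HasDerivAt (fun z => (z - I) / (z + I)) (2 * I / (z + I) ^ 2) z := by
    intro z hz
    have := ((hasDerivAt_id z).sub_const I).div ((hasDerivAt_id z).add_const I)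
      (add_I_ne_zero hz)
    refine this.congr_deriv ?_
    simp only [id]
    congr 1
    ring
  refine ⟨fun z => p ((z - I) / (z + I)), ?_, ?_, ?_, ?_, ?_⟩
  · intro z hz
    exact (hd _ (hmem z hz)).comp z (hder z hz).differentiableAt
  · exact hcov.comp_homeomorph cayleyHomeo
  · intro z
    rw [← himg]
    exact mem_image_of_mem _ (hmem z z.im_pos)
  · intro x hx
    rw [← himg] at hx
    obtain ⟨w, hw, rfl⟩ := hx
    refine ⟨cayleyHomeo.symm ⟨w, hw⟩, ?_⟩
    have := congrArg Subtype.val (cayleyHomeo.apply_symm_apply ⟨w, hw⟩)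
    exact congrArg p this
  · intro z
    have hz := z.im_pos
    have h1 := (hd _ (hmem z hz)).hasDerivAt.comp (z:ℂ) (hder z hz)
    have h2 : deriv (fun z => p ((z - I) / (z + I))) (z:ℂ) = _ := h1.deriv
    have h3 := hdens _ (hmem z hz)
    have h4 : ‖(z:ℂ) + I‖ ≠ 0 := norm_ne_zero_iff.2 (add_I_ne_zero hz)
    have h5 : z.im ≠ 0 := hz.ne'
    rw [one_sub_normSq_cayley hz] at h3
    rw [h2, norm_mul, ← mul_assoc, h3]
    simp only [norm_div, norm_mul, norm_pow, Complex.norm_I, Complex.norm_ofNat]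
    change 2 / (4 * z.im / _) * _ = _
    field_simp
    norm_num

/-- The Schwarz–Pick lemma for holomorphic self-maps of the upper half plane. -/
lemma norm_deriv_mul_im_le {f : ℂ → ℂ} (hf : ∀ z : ℂ, 0 < z.im → DifferentiableAt ℂ f z)
    (hpos : ∀ z : ℂ, 0 < z.im → 0 < (f z).im) {a : ℂ} (ha : 0 < a.im) :
    ‖deriv f a‖ * a.im ≤ (f a).im := by
  set b := f a with hb
  have hbi : 0 < b.im := hpos a ha
  have hbb : ∀ w : ℂ, 0 < w.im → w - conj b ≠ 0 := by
    intro w hw h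
    have := congrArg Complex.im h
    simp at this
    linarith
  have hne : ∀ w ∈ ball (0:ℂ) 1, 1 - w ≠ 0 := by
    intro w hw h
    rw [mem_ball_zero_iff, ← sub_eq_zero.1 h] at hw
    simp at hw
  have hφ : ∀ w ∈ ball (0:ℂ) 1, 0 < ((a - conj a * w) / (1 - w)).im := by
    intro w hw
    have h1 : 0 < Complex.normSq (1 - w) := Complex.normSq_pos.2 (hne w hw)
    rw [mem_ball_zero_iff] at hw
    have h3 : Complex.normSq w < 1 := by
      rw [Complex.normSq_eq_norm_sq]
      nlinarith [norm_nonneg w]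
    have h4 : ((a - conj a * w) / (1 - w)).im =
        a.im * (1 - Complex.normSq w) / Complex.normSq (1 - w) := by
      rw [Complex.div_im]
      simp [Complex.normSq_apply]
      ring
    rw [h4]
    exact div_pos (mul_pos ha (by linarith)) h1
  have hφd : ∀ w ∈ ball (0:ℂ) 1,
      HasDerivAt (fun w => (a - conj a * w) / (1 - w)) ((a - conj a) / (1 - w) ^ 2) w := by
    intro w hw
    have := (((hasDerivAt_id w).const_mul (conj a)).const_sub a).div
      ((hasDerivAt_id w).const_sub 1) (hne w hw)
    refine this.congr_deriv ?_
    simp only [id]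
    congr 1
    ring
  have hψd : ∀ w : ℂ, 0 < w.im →
      HasDerivAt (fun w => (w - b) / (w - conj b)) ((b - conj b) / (w - conj b) ^ 2) w := by
    intro w hw
    have := ((hasDerivAt_id w).sub_const b).div ((hasDerivAt_id w).sub_const (conj b)) (hbb w hw)
    refine this.congr_deriv ?_
    simp only [id]
    congr 1
    ring
  have hψ : ∀ w : ℂ, 0 < w.im → ‖(w - b) / (w - conj b)‖ ≤ 1 := by
    intro w hw
    rw [norm_div]
    refine div_le_one_of_le₀ ?_ (norm_nonneg _)
    rw [Complex.norm_def, Complex.norm_def]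
    apply Real.sqrt_le_sqrt
    rw [Complex.normSq_apply, Complex.normSq_apply]
    simp
    nlinarith
  set g : ℂ → ℂ := fun w => (f ((a - conj a * w) / (1 - w)) - b) /
    (f ((a - conj a * w) / (1 - w)) - conj b) with hg
  have h0 : (0:ℂ) ∈ ball (0:ℂ) 1 := by simp
  have hgd : ∀ w ∈ ball (0:ℂ) 1, HasDerivAt g
      ((b - conj b) / (f ((a - conj a * w) / (1 - w)) - conj b) ^ 2 *
        (deriv f ((a - conj a * w) / (1 - w)) * ((a - conj a) / (1 - w) ^ 2))) w := by
    intro w hw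
    exact (hψd _ (hpos _ (hφ w hw))).comp w
      ((hf _ (hφ w hw)).hasDerivAt.comp w (hφd w hw))
  have hg0 : g 0 = 0 := by simp [hg, hb]
  have hmain := Complex.norm_deriv_le_one_of_mapsTo_ball (f := g) (c := 0) (R := 1)
    (fun w hw => (hgd w hw).differentiableAt.differentiableWithinAt)
    (by
      intro w hw
      rw [hg0, mem_closedBall_zero_iff]
      exact hψ _ (hpos _ (hφ w hw))) one_pos
  rw [(hgd 0 h0).deriv] at hmain
  simp only [mul_zero, sub_zero, div_one, one_pow, ← hb] at hmain
  have e1 : ‖b - conj b‖ = 2 * b.im := by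
    rw [Complex.sub_conj]
    simp [abs_of_pos hbi]
  have e2 : ‖a - conj a‖ = 2 * a.im := by
    rw [Complex.sub_conj]
    simp [abs_of_pos ha]
  rw [norm_mul, norm_mul, norm_div, norm_pow, e1, e2] at hmain
  have : 2 * b.im / (2 * b.im) ^ 2 * (‖deriv f a‖ * (2 * a.im)) = ‖deriv f a‖ * a.im / b.im := by
    field_simp
  rw [this, div_le_one hbi] at hmain
  exact hmain

end HalfPlane

namespace IsHalfPlaneCover

open UpperHalfPlane hiding I

variable {Ω : Set ℂ} {lam : ℂ → ℝ} {Q : ℂ → ℂ}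

lemma analyticAt (H : IsHalfPlaneCover Ω lam Q) {z : ℂ} (hz : 0 < z.im) : AnalyticAt ℂ Q z := by
  have hopen : IsOpen {z : ℂ | 0 < z.im} := isOpen_lt continuous_const Complex.continuous_im
  exact DifferentiableOn.analyticAt (s := {z : ℂ | 0 < z.im})
    (fun w hw => (H.differentiableAt w hw).differentiableWithinAt) (hopen.mem_nhds hz)

lemma hasStrictDerivAt (H : IsHalfPlaneCover Ω lam Q) {z : ℂ} (hz : 0 < z.im) :
    HasStrictDerivAt Q (deriv Q z) z :=
  (H.analyticAt hz).hasStrictDerivAt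

lemma norm_deriv_pos (H : IsHalfPlaneCover Ω lam Q) (z : ℍ) : 0 < ‖deriv Q z‖ := by
  have h := H.density z
  have h1 : 0 < 1 / z.im := one_div_pos.2 z.im_pos
  rw [← h] at h1
  rcases (norm_nonneg (deriv Q z)).lt_or_eq with h2 | h2
  · exact h2
  · rw [← h2, mul_zero] at h1
    exact absurd h1 (lt_irrefl _)

lemma deriv_ne_zero (H : IsHalfPlaneCover Ω lam Q) (z : ℍ) : deriv Q z ≠ 0 :=
  norm_pos_iff.1 (H.norm_deriv_pos z)

lemma lam_eq (H : IsHalfPlaneCover Ω lam Q) (z : ℍ) : lam (Q z) = 1 / (z.im * ‖deriv Q z‖) := by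
  have h1 := H.norm_deriv_pos z
  rw [← div_div, ← H.density z, mul_div_cancel_right₀ _ h1.ne']

lemma lam_pos (H : IsHalfPlaneCover Ω lam Q) {x : ℂ} (hx : x ∈ Ω) : 0 < lam x := by
  obtain ⟨z, rfl⟩ := H.surj x hx
  rw [H.lam_eq]
  exact one_div_pos.2 (mul_pos z.im_pos (H.norm_deriv_pos z))

lemma continuousAt_lam (H : IsHalfPlaneCover Ω lam Q) {x : ℂ} (hx : x ∈ Ω) :
    ContinuousAt lam x := by
  obtain ⟨z, rfl⟩ := H.surj x hx
  have hQ := H.hasStrictDerivAt z.im_pos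
  have hne := H.deriv_ne_zero z
  set ψ := hQ.localInverse Q _ _ hne with hψ
  have hψz : ψ (Q z) = z := (hQ.eventually_left_inverse hne).self_of_nhds
  have hψc : ContinuousAt ψ (Q z) := (hQ.to_localInverse hne).hasDerivAt.continuousAt
  have hinv : ∀ᶠ x in 𝓝 (Q z), Q (ψ x) = x := hQ.eventually_right_inverse hne
  have him : ∀ᶠ x in 𝓝 (Q z), 0 < (ψ x).im := by
    have : ContinuousAt (fun x => (ψ x).im) (Q z) :=
      Complex.continuous_im.continuousAt.comp hψc
    exact this.eventually (lt_mem_nhds (by simp only [hψz]; exact z.im_pos))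
  have hev : (fun x => 1 / ((ψ x).im * ‖deriv Q (ψ x)‖)) =ᶠ[𝓝 (Q z)] lam := by
    filter_upwards [hinv, him] with x h1 h2
    have := H.lam_eq ⟨ψ x, h2⟩
    simp only at this
    rw [h1] at this
    exact this.symm
  refine ContinuousAt.congr ?_ hev
  have hd : ContinuousAt (fun x => deriv Q (ψ x)) (Q z) := by
    refine ContinuousAt.comp (g := deriv Q) ?_ hψc
    rw [hψz]
    exact (H.analyticAt z.im_pos).deriv.continuousAt
  refine continuousAt_const.div ((Complex.continuous_im.continuousAt.comp hψc).mul hd.norm) ?_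
  have := mul_pos z.im_pos (H.norm_deriv_pos z)
  simp only [hψz]
  exact this.ne'

lemma exists_lift (H : IsHalfPlaneCover Ω lam Q) {A : Type*} [TopologicalSpace A]
    [SimplyConnectedSpace A] [LocallyPathConnectedSpace A] {f : A → ℂ} (hf : Continuous f)
    (hfΩ : ∀ a, f a ∈ Ω) {a₀ : A} {z₀ : ℍ} (h : Q z₀ = f a₀) :
    ∃ F : A → ℍ, Continuous F ∧ F a₀ = z₀ ∧ ∀ a, Q (F a) = f a := by
  obtain ⟨F, ⟨h1, h2⟩, -⟩ := H.covering.existsUnique_continuousMap_lifts ⟨f, hf⟩ (a₀ := a₀)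
    (e₀ := z₀) h hfΩ
  exact ⟨F, F.continuous, h1, fun a => congrFun h2 a⟩

lemma lift_eqOn (H : IsHalfPlaneCover Ω lam Q) {A : Type*} [TopologicalSpace A] {s : Set A}
    (hs : IsPreconnected s) {f g : A → ℍ} (hf : ContinuousOn f s) (hg : ContinuousOn g s)
    (h : ∀ a ∈ s, Q (f a) = Q (g a)) {a₀ : A} (ha₀ : a₀ ∈ s) (h₀ : f a₀ = g a₀) : EqOn f g s := by
  have hu : (fun z : ℍ => Q z) ⁻¹' Ω = univ := eq_univ_of_forall H.mem
  have hc := H.covering.isCoveringMap_restrictPreimage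
  have hm : ∀ z : ℍ, z ∈ (fun z : ℍ => Q z) ⁻¹' Ω := H.mem
  have key := hc.eqOn_of_comp_eqOn (g₁ := fun a => ⟨f a, hm (f a)⟩) (g₂ := fun a => ⟨g a, hm (g a)⟩)
    hs (continuousOn_iff_continuous_domRestrict.2 (hf.domRestrict.subtype_mk _))
    (continuousOn_iff_continuous_domRestrict.2 (hg.domRestrict.subtype_mk _))
    (fun a ha => Subtype.ext (h a ha)) ha₀ (Subtype.ext h₀)
  exact fun a ha => congrArg Subtype.val (key ha)

lemma hasDerivAt_of_lift (H : IsHalfPlaneCover Ω lam Q) {g q : ℂ → ℂ} {z q' : ℂ}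
    (hg : ContinuousAt g z) (hgz : 0 < (g z).im) (h : ∀ᶠ w in 𝓝 z, Q (g w) = q w)
    (hq : HasDerivAt q q' z) : HasDerivAt g ((deriv Q (g z))⁻¹ * q') z := by
  have hQ := H.hasStrictDerivAt hgz
  have hne := H.deriv_ne_zero ⟨g z, hgz⟩
  simp only at hne
  have h1 : HasDerivAt (hQ.localInverse Q _ _ hne) (deriv Q (g z))⁻¹ (q z) := by
    rw [← h.self_of_nhds]
    exact (hQ.to_localInverse hne).hasDerivAt
  refine (h1.comp z hq).congr_of_eventuallyEq ?_
  filter_upwards [h, hg.eventually (hQ.eventually_left_inverse hne)] with w h2 h3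
  rw [Function.comp_apply, ← h2, h3]

lemma lam_conj_le (H : IsHalfPlaneCover Ω lam Q) (hΩ : ∀ x ∈ Ω, conj x ∈ Ω) {w : ℂ}
    (hw : w ∈ Ω) : lam (conj w) ≤ lam w := by
  obtain ⟨z₁, rfl⟩ := H.surj w hw
  let J : ℂ → ℂ := fun z => -conj z
  have hJ : ∀ z : ℂ, 0 < z.im → 0 < (J z).im := fun z hz => by simpa [J]
  have hJJ : ∀ z : ℂ, J (J z) = z := fun z => by simp [J]
  let q : ℂ → ℂ := fun z => conj (Q (J z))
  have hq : ∀ z : ℂ, 0 < z.im → HasDerivAt q (-conj (deriv Q (J z))) z := by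
    intro z hz
    have h1 : HasDerivAt (fun z => Q (-z)) (-deriv Q (-conj z)) (conj z) := by
      have h2 := (H.differentiableAt (J z) (hJ z hz)).hasDerivAt
      have h3 := HasDerivAt.comp (conj z) h2 (hasDerivAt_neg (conj z))
      exact h3.congr_deriv (by simp [J])
    have h2 := h1.conj_conj
    rw [Complex.conj_conj] at h2
    exact h2.congr_deriv (by simp [J])
  have hqΩ : ∀ z : ℍ, q z ∈ Ω := fun z => hΩ _ (H.mem ⟨J z, hJ z z.im_pos⟩)
  have hqc : Continuous fun z : ℍ => q z := continuous_iff_continuousAt.2 fun z =>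
    (hq z z.im_pos).continuousAt.comp UpperHalfPlane.continuous_coe.continuousAt
  let z : ℍ := ⟨J z₁, hJ z₁ z₁.im_pos⟩
  have hqz : q z = conj (Q z₁) := by simp only [q, z, hJJ]
  obtain ⟨y, hy⟩ := H.surj _ (hqΩ z)
  obtain ⟨F, hFc, hFz, hFQ⟩ := H.exists_lift hqc hqΩ (a₀ := z) hy
  let f : ℂ → ℂ := fun z => F (ofComplex z)
  have hfim : ∀ w : ℂ, 0 < w.im → 0 < (f w).im := fun w _ => (F (ofComplex w)).im_pos
  have hopen : IsOpen {z : ℂ | 0 < z.im} := isOpen_lt continuous_const Complex.continuous_im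
  have hfd : ∀ w : ℂ, 0 < w.im →
      HasDerivAt f ((deriv Q (f w))⁻¹ * -conj (deriv Q (J w))) w := by
    intro w hw
    refine H.hasDerivAt_of_lift (q := q) ?_ (hfim w hw) ?_ (hq w hw)
    · have h1 : ContinuousAt (fun w => ofComplex w) w :=
        ofComplex.continuousAt (by simpa [ofComplex] using hw)
      exact (UpperHalfPlane.continuous_coe.comp hFc).continuousAt.comp h1
    · filter_upwards [hopen.mem_nhds hw] with v hv
      rw [hFQ, ofComplex_apply_of_im_pos hv]
  have hSP := norm_deriv_mul_im_le (fun w hw => (hfd w hw).differentiableAt) hfim z.im_pos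
  have hfz : f z = F z := by simp only [f, ofComplex_apply]
  rw [(hfd z z.im_pos).deriv, hfz, norm_mul, norm_inv, norm_neg, RCLike.norm_conj] at hSP
  have e1 := H.density (F z)
  rw [hFQ, hqz] at e1
  have hJz : J z = z₁ := by simp only [z, hJJ]
  have hzim : (z : ℂ).im = z₁.im := by simp [z, J]
  rw [hJz, hzim] at hSP
  have e2 := H.density z₁
  have p1 := H.norm_deriv_pos (F z)
  have p2 := H.norm_deriv_pos z₁
  have p3 := z₁.im_pos
  have p4 := (F z).im_pos
  have e1' : lam (conj (Q z₁)) = 1 / (‖deriv Q (F z)‖ * (F z).im) := by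
    rw [eq_div_iff (by positivity), ← mul_assoc, e1, one_div, inv_mul_cancel₀ p4.ne']
  have e2' : lam (Q z₁) = 1 / (‖deriv Q z₁‖ * z₁.im) := by
    rw [eq_div_iff (by positivity), ← mul_assoc, e2, one_div, inv_mul_cancel₀ p3.ne']
  rw [e1', e2']
  apply one_div_le_one_div_of_le (by positivity)
  rw [mul_assoc, inv_mul_le_iff₀ p1] at hSP
  exact hSP

lemma lam_conj (H : IsHalfPlaneCover Ω lam Q) (hΩ : ∀ x ∈ Ω, conj x ∈ Ω) {w : ℂ}
    (hw : w ∈ Ω) : lam (conj w) = lam w :=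
  le_antisymm (H.lam_conj_le hΩ hw) (by simpa using H.lam_conj_le hΩ (hΩ w hw))

end IsHalfPlaneCover

section HalfPlaneGeometry

open UpperHalfPlane hiding I

lemma norm_ofReal_add_mul_I_sq (a b : ℝ) : ‖(a:ℂ) + b * I‖ ^ 2 = a ^ 2 + b ^ 2 := by
  rw [← Complex.normSq_eq_norm_sq, Complex.normSq_add_mul_I]

/-- A unit speed parametrization of a hyperbolic line. -/
structure IsHyperbolicLine (σ : ℝ → ℍ) : Prop where
  isometry : Isometry σ
  contDiff : ContDiff ℝ 1 fun t => (σ t : ℂ)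
  norm_deriv_le : ∀ t, ‖deriv (fun t => (σ t : ℂ)) t‖ ≤ (σ t).im

lemma isHyperbolicLine_vertical (x : ℝ) :
    IsHyperbolicLine fun t => ⟨⟨x, Real.exp t⟩, Real.exp_pos t⟩ := by
  have hfun : (fun t : ℝ => (⟨x, Real.exp t⟩ : ℂ)) = fun t : ℝ => (x:ℂ) + (Real.exp t : ℝ) * I := by
    funext t
    apply Complex.ext <;> simp [Complex.exp_ofReal_re, Complex.exp_ofReal_im]
  refine ⟨UpperHalfPlane.isometry_vertical_line x, ?_, ?_⟩
  · change ContDiff ℝ 1 fun t : ℝ => (⟨x, Real.exp t⟩ : ℂ)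
    rw [hfun]
    exact contDiff_const.add
      ((Complex.ofRealCLM.contDiff.comp Real.contDiff_exp).mul contDiff_const)
  · intro t
    change ‖deriv (fun t : ℝ => (⟨x, Real.exp t⟩ : ℂ)) t‖ ≤ Real.exp t
    rw [hfun]
    have : HasDerivAt (fun t : ℝ => (x:ℂ) + (Real.exp t : ℝ) * I) ((Real.exp t : ℝ) * I) t :=
      ((Real.hasDerivAt_exp t).ofReal_comp.mul_const I).const_add _
    rw [this.deriv, norm_mul, Complex.norm_I, mul_one, Complex.norm_real, Real.norm_eq_abs,
      abs_of_pos (Real.exp_pos t)]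

lemma isHyperbolicLine_semicircle (x : ℝ) {r : ℝ} (hr : 0 < r) :
    IsHyperbolicLine fun t => ⟨⟨x + r * (Real.sinh t / Real.cosh t), r / Real.cosh t⟩,
      div_pos hr (Real.cosh_pos t)⟩ := by
  have hfun : (fun t : ℝ => (⟨x + r * (Real.sinh t / Real.cosh t), r / Real.cosh t⟩ : ℂ)) =
      fun t : ℝ => ((x + r * (Real.sinh t / Real.cosh t) : ℝ) : ℂ) +
        ((r / Real.cosh t : ℝ) : ℂ) * I := by
    funext t
    rw [← Complex.mk_eq_add_mul_I]
  have hc : ∀ t, Real.cosh t ≠ 0 := fun t => (Real.cosh_pos t).ne'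
  refine ⟨Isometry.of_dist_eq fun u v => ?_, ?_, ?_⟩
  · have h : Real.cosh (dist (⟨⟨x + r * (Real.sinh u / Real.cosh u), r / Real.cosh u⟩,
        div_pos hr (Real.cosh_pos u)⟩ : ℍ) ⟨⟨x + r * (Real.sinh v / Real.cosh v),
        r / Real.cosh v⟩, div_pos hr (Real.cosh_pos v)⟩) = Real.cosh (u - v) := by
      rw [UpperHalfPlane.cosh_dist', Real.cosh_sub]
      change ((x + r * (Real.sinh u / Real.cosh u) - (x + r * (Real.sinh v / Real.cosh v))) ^ 2 +
        (r / Real.cosh u) ^ 2 + (r / Real.cosh v) ^ 2) / (2 * (r / Real.cosh u) *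
        (r / Real.cosh v)) = _
      have h1 := hc u
      have h2 := hc v
      have h3 := Real.sinh_sq u
      have h4 := Real.sinh_sq v
      field_simp
      linear_combination r ^ 2 * (Real.cosh v) ^ 2 * h3 + r ^ 2 * (Real.cosh u) ^ 2 * h4
    rw [Real.dist_eq]
    refine le_antisymm ?_ ?_
    · have := Real.cosh_le_cosh.1 h.le
      rwa [abs_of_nonneg dist_nonneg] at this
    · have := Real.cosh_le_cosh.1 h.ge
      rwa [abs_of_nonneg (a := dist _ _) dist_nonneg] at this
  · change ContDiff ℝ 1
      fun t : ℝ => (⟨x + r * (Real.sinh t / Real.cosh t), r / Real.cosh t⟩ : ℂ)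
    rw [hfun]
    have h1 : ContDiff ℝ 1 fun t => x + r * (Real.sinh t / Real.cosh t) :=
      contDiff_const.add (contDiff_const.mul (Real.contDiff_sinh.div Real.contDiff_cosh hc))
    have h2 : ContDiff ℝ 1 fun t => r / Real.cosh t := contDiff_const.div Real.contDiff_cosh hc
    exact (Complex.ofRealCLM.contDiff.comp h1).add
      ((Complex.ofRealCLM.contDiff.comp h2).mul contDiff_const)
  · intro t
    change ‖deriv (fun t : ℝ =>
      (⟨x + r * (Real.sinh t / Real.cosh t), r / Real.cosh t⟩ : ℂ)) t‖ ≤ r / Real.cosh t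
    rw [hfun]
    have h1 := (((Real.hasDerivAt_sinh t).div (Real.hasDerivAt_cosh t) (hc t)).const_mul
      r).const_add x
    have h2 := (hasDerivAt_const t r).div (Real.hasDerivAt_cosh t) (hc t)
    have h3 := h1.ofReal_comp.add (h2.ofReal_comp.mul_const I)
    have h4 : deriv (fun t : ℝ => ((x + r * (Real.sinh t / Real.cosh t) : ℝ) : ℂ) +
        ((r / Real.cosh t : ℝ) : ℂ) * I) t = _ := h3.deriv
    rw [h4]
    refine abs_le_of_sq_le_sq' ?_ (div_pos hr (Real.cosh_pos t)).le |>.2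
    rw [norm_ofReal_add_mul_I_sq]
    have h5 := hc t
    have h6 := Real.cosh_sq t
    apply le_of_eq
    field_simp
    rw [h6]
    ring

lemma exists_isHyperbolicLine (z w : ℍ) : ∃ σ, IsHyperbolicLine σ ∧ ∃ u v, σ u = z ∧ σ v = w := by
  have hz := z.im_pos
  have hw := w.im_pos
  by_cases h : z.re = w.re
  · refine ⟨_, isHyperbolicLine_vertical z.re, Real.log z.im, Real.log w.im, ?_, ?_⟩
    · apply UpperHalfPlane.ext
      apply Complex.ext
      · rfl
      · exact Real.exp_log hz
    · apply UpperHalfPlane.ext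
      apply Complex.ext
      · exact h
      · exact Real.exp_log hw
  · have hne : w.re - z.re ≠ 0 := fun h' => h (by linarith)
    obtain ⟨x, hx⟩ : ∃ x, (z.re - x) ^ 2 + z.im ^ 2 = (w.re - x) ^ 2 + w.im ^ 2 := by
      refine ⟨(w.re ^ 2 + w.im ^ 2 - z.re ^ 2 - z.im ^ 2) / (2 * (w.re - z.re)), ?_⟩
      field_simp
      ring
    set r := √((z.re - x) ^ 2 + z.im ^ 2) with hr
    have hr0 : 0 < r := Real.sqrt_pos.2 (by positivity)
    have hr2 : r ^ 2 = (z.re - x) ^ 2 + z.im ^ 2 := Real.sq_sqrt (by positivity)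
    have key : ∀ y : ℍ, (y.re - x) ^ 2 + y.im ^ 2 = r ^ 2 →
        (⟨⟨x + r * (Real.sinh (Real.arsinh ((y.re - x) / y.im)) /
          Real.cosh (Real.arsinh ((y.re - x) / y.im))),
          r / Real.cosh (Real.arsinh ((y.re - x) / y.im))⟩,
          div_pos hr0 (Real.cosh_pos _)⟩ : ℍ) = y := by
      intro y hy
      have hy0 := y.im_pos
      have hcosh : Real.cosh (Real.arsinh ((y.re - x) / y.im)) = r / y.im := by
        rw [Real.cosh_arsinh, ← Real.sqrt_sq (div_pos hr0 hy0).le, div_pow, div_pow, ← hy]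
        congr 1
        field_simp
        ring
      apply UpperHalfPlane.ext
      apply Complex.ext
      · change x + r * (Real.sinh (Real.arsinh ((y.re - x) / y.im)) /
          Real.cosh (Real.arsinh ((y.re - x) / y.im))) = y.re
        rw [Real.sinh_arsinh, hcosh]
        field_simp
        ring
      · change r / Real.cosh (Real.arsinh ((y.re - x) / y.im)) = y.im
        rw [hcosh]
        field_simp
    exact ⟨_, isHyperbolicLine_semicircle x hr0, _, _, key z hr2.symm, key w (by rw [hr2, hx])⟩

lemma IsHyperbolicLine.comp_affine {σ : ℝ → ℍ} (h : IsHyperbolicLine σ) {ε : ℝ} (hε : |ε| = 1)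
    (u : ℝ) : IsHyperbolicLine fun t => σ (u + ε * t) := by
  refine ⟨Isometry.of_dist_eq fun s t => ?_, ?_, fun t => ?_⟩
  · rw [h.isometry.dist_eq, Real.dist_eq, Real.dist_eq, add_sub_add_left_eq_sub, ← mul_sub,
      abs_mul, hε, one_mul]
  · exact h.contDiff.comp (contDiff_const.add (contDiff_const.mul contDiff_id))
  · have h1 : HasDerivAt (fun t => u + ε * t) (ε * 1) t :=
      ((hasDerivAt_id t).const_mul ε).const_add u
    have h2 := ((h.contDiff.differentiable one_ne_zero) (u + ε * t)).hasDerivAt.scomp t h1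
    have h3 : deriv (fun t => (σ (u + ε * t) : ℂ)) t = _ := h2.deriv
    rw [h3, mul_one, norm_smul, Real.norm_eq_abs, hε, one_mul]
    exact h.norm_deriv_le _

lemma exists_isHyperbolicLine_from (z w : ℍ) :
    ∃ σ, IsHyperbolicLine σ ∧ σ 0 = z ∧ σ (dist z w) = w := by
  obtain ⟨σ, hσ, u, v, rfl, rfl⟩ := exists_isHyperbolicLine z w
  rcases le_total u v with h | h
  · refine ⟨_, hσ.comp_affine (ε := 1) (by simp) u, by simp, ?_⟩
    rw [hσ.isometry.dist_eq, Real.dist_eq, abs_of_nonpos (by linarith)]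
    congr 1; ring
  · refine ⟨_, hσ.comp_affine (ε := -1) (by simp) u, by simp, ?_⟩
    rw [hσ.isometry.dist_eq, Real.dist_eq, abs_of_nonneg (by linarith)]
    congr 1; ring

lemma exp_div_four_le_sinh {x : ℝ} (hx : 1 ≤ x) : Real.exp x / 4 ≤ Real.sinh x := by
  rw [Real.sinh_eq]
  have h1 := Real.add_one_le_exp x
  have h2 : Real.exp (-x) * Real.exp x = 1 := by rw [← Real.exp_add]; simp
  have h3 := Real.exp_pos (-x)
  nlinarith

lemma sinh_le_exp_div_two (x : ℝ) : Real.sinh x ≤ Real.exp x / 2 := by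
  rw [Real.sinh_eq]
  have h3 := Real.exp_pos (-x)
  linarith

lemma log_eight_le : Real.log 8 ≤ 3 := by
  rw [Real.log_le_iff_le_exp (by norm_num)]
  have h := Real.add_one_le_exp (1:ℝ)
  have h2 : Real.exp 3 = Real.exp 1 ^ 3 := by rw [← Real.exp_nat_mul]; norm_num
  rw [h2]
  nlinarith [sq_nonneg (Real.exp 1 - 2), sq_nonneg (Real.exp 1 + 2)]

lemma UpperHalfPlane.sinh_ptolemy (a b c e : ℍ) :
    Real.sinh (dist a c / 2) * Real.sinh (dist b e / 2) ≤
      Real.sinh (dist a b / 2) * Real.sinh (dist c e / 2) +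
        Real.sinh (dist b c / 2) * Real.sinh (dist a e / 2) := by
  have h := EuclideanGeometry.mul_dist_le_mul_dist_add_mul_dist (a:ℂ) (b:ℂ) (c:ℂ) (e:ℂ)
  simp only [sinh_half_dist, Real.sqrt_mul a.im_pos.le, Real.sqrt_mul b.im_pos.le,
    Real.sqrt_mul c.im_pos.le]
  have ha := Real.sqrt_pos.2 a.im_pos
  have hb := Real.sqrt_pos.2 b.im_pos
  have hc := Real.sqrt_pos.2 c.im_pos
  have he := Real.sqrt_pos.2 e.im_pos
  field_simp
  linarith

/-- The four point condition for the hyperbolic plane. -/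
lemma UpperHalfPlane.dist_add_dist_le_max (a b c e : ℍ) :
    dist a c + dist b e ≤ max (dist a b + dist c e) (dist a e + dist b c) + 6 := by
  have t1 := dist_triangle a b e
  have t2 := dist_triangle c b e
  have t3 := dist_triangle b a c
  have t4 := dist_triangle e a c
  have s1 := dist_comm b a
  have s2 := dist_comm e c
  have s3 := dist_comm c b
  have s4 := dist_comm e a
  have m1 := le_max_left (dist a b + dist c e) (dist a e + dist b c)
  have m2 := le_max_right (dist a b + dist c e) (dist a e + dist b c)
  rcases le_total (dist a c) 2 with h | h
  · linarith [dist_triangle b c e]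
  rcases le_total (dist b e) 2 with h' | h'
  · linarith [dist_triangle a b c, dist_triangle a e c]
  have hp := UpperHalfPlane.sinh_ptolemy a b c e
  set m := max (dist a b + dist c e) (dist a e + dist b c)
  have h1 := exp_div_four_le_sinh (x := dist a c / 2) (by linarith)
  have h2 := exp_div_four_le_sinh (x := dist b e / 2) (by linarith)
  have hs : ∀ x y : ℝ, 0 ≤ x → 0 ≤ y → x + y ≤ m →
      Real.sinh (x / 2) * Real.sinh (y / 2) ≤ Real.exp (m / 2) / 4 := by
    intro x y hx hy hxy
    calc Real.sinh (x / 2) * Real.sinh (y / 2) ≤ (Real.exp (x / 2) / 2) * (Real.exp (y / 2) / 2) :=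
          mul_le_mul (sinh_le_exp_div_two _) (sinh_le_exp_div_two _)
            (Real.sinh_nonneg_iff.2 (by linarith)) (by positivity)
      _ = Real.exp ((x + y) / 2) / 4 := by
          rw [show (x + y) / 2 = x / 2 + y / 2 by ring, Real.exp_add]; ring
      _ ≤ _ := by gcongr
  have h3 := hs _ _ (dist_nonneg (x := a) (y := b)) (dist_nonneg (x := c) (y := e)) m1
  have h4 := hs _ _ (dist_nonneg (x := b) (y := c)) (dist_nonneg (x := a) (y := e)) (by linarith)
  have h5 : Real.exp (dist a c / 2) / 4 * (Real.exp (dist b e / 2) / 4) ≤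
      Real.sinh (dist a c / 2) * Real.sinh (dist b e / 2) :=
    mul_le_mul h1 h2 (by positivity) (Real.sinh_nonneg_iff.2 (by linarith))
  have h6 : Real.exp ((dist a c + dist b e) / 2) ≤ 8 * Real.exp (m / 2) := by
    rw [show (dist a c + dist b e) / 2 = dist a c / 2 + dist b e / 2 by ring, Real.exp_add]
    linarith
  rw [← Real.exp_log (show (0:ℝ) < 8 by norm_num), ← Real.exp_add, Real.exp_le_exp] at h6
  linarith [log_eight_le]

end HalfPlaneGeometry

/-- `F` is a distance nonincreasing map of `Ω` into itself preserving the density `lam`. -/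
structure IsDensityFold (Ω : Set ℂ) (lam : ℂ → ℝ) (F : ℂ → ℂ) : Prop where
  mem : ∀ x ∈ Ω, F x ∈ Ω
  lipschitz : LipschitzWith 1 F
  lam_eq : ∀ x ∈ Ω, lam (F x) = lam x

lemma isDensityFold_id (Ω : Set ℂ) (lam : ℂ → ℝ) : IsDensityFold Ω lam id :=
  ⟨fun _ h => h, LipschitzWith.id, fun _ _ => rfl⟩

lemma IsDensityFold.comp {Ω : Set ℂ} {lam : ℂ → ℝ} {F G : ℂ → ℂ} (hF : IsDensityFold Ω lam F)
    (hG : IsDensityFold Ω lam G) : IsDensityFold Ω lam (F ∘ G) :=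
  ⟨fun x hx => hF.mem _ (hG.mem x hx), by simpa using hF.lipschitz.comp hG.lipschitz,
    fun x hx => (hF.lam_eq _ (hG.mem x hx)).trans (hG.lam_eq x hx)⟩

lemma lipschitzWith_foldUp : LipschitzWith 1 foldUp := by
  refine LipschitzWith.of_dist_le_mul fun z w => ?_
  rw [NNReal.coe_one, one_mul, Complex.dist_eq_re_im, Complex.dist_eq_re_im]
  apply Real.sqrt_le_sqrt
  simp only [foldUp]
  have := sq_le_sq.2 (abs_abs_sub_abs_le_abs_sub z.im w.im)
  linarith

namespace IsHalfPlaneCover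

open UpperHalfPlane hiding I

variable {Ω : Set ℂ} {lam : ℂ → ℝ} {Q : ℂ → ℂ}

lemma isDensityFold_conj (H : IsHalfPlaneCover Ω lam Q) (hΩ : ∀ x ∈ Ω, conj x ∈ Ω) :
    IsDensityFold Ω lam conj :=
  ⟨hΩ, Complex.isometry_conj.lipschitz, fun _ hx => H.lam_conj hΩ hx⟩

lemma isDensityFold_foldUp (H : IsHalfPlaneCover Ω lam Q) (hΩ : ∀ x ∈ Ω, conj x ∈ Ω) :
    IsDensityFold Ω lam foldUp := by
  refine ⟨fun x hx => ?_, lipschitzWith_foldUp, fun x hx => ?_⟩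
  · rcases le_total 0 x.im with h | h
    · rwa [foldUp_of_nonneg h]
    · rw [foldUp_of_nonpos h]; exact hΩ x hx
  · rcases le_total 0 x.im with h | h
    · rw [foldUp_of_nonneg h]
    · rw [foldUp_of_nonpos h, H.lam_conj hΩ hx]

lemma curveLen_nonneg (H : IsHalfPlaneCover Ω lam Q) {γ : ℝ → ℂ}
    (hγ : ∀ t ∈ Icc (0:ℝ) 1, γ t ∈ Ω) : 0 ≤ curveLen lam γ :=
  intervalIntegral.integral_nonneg zero_le_one fun t ht =>
    mul_nonneg (H.lam_pos (hγ t ht)).le (norm_nonneg _)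

lemma densityDist_le_curveLen (H : IsHalfPlaneCover Ω lam Q) {γ : ℝ → ℂ}
    (hc : ContDiffOn ℝ 1 γ (Icc 0 1)) (hγ : ∀ t ∈ Icc (0:ℝ) 1, γ t ∈ Ω) :
    densityDist Ω lam (γ 0) (γ 1) ≤ curveLen lam γ := by
  refine csInf_le ⟨0, ?_⟩ ⟨γ, hc, rfl, rfl, hγ, rfl⟩
  rintro _ ⟨γ', -, -, -, h, rfl⟩
  exact H.curveLen_nonneg h

lemma exists_curve (H : IsHalfPlaneCover Ω lam Q) (z w : ℍ) :
    ∃ γ : ℝ → ℂ, ContDiffOn ℝ 1 γ (Icc 0 1) ∧ γ 0 = Q z ∧ γ 1 = Q w ∧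
      (∀ t ∈ Icc (0:ℝ) 1, γ t ∈ Ω) ∧ curveLen lam γ ≤ dist z w := by
  obtain ⟨σ, hσ, h0, h1⟩ := exists_isHyperbolicLine_from z w
  set L := dist z w
  let τ : ℝ → ℂ := fun t => σ (L * t)
  have hτ : ContDiff ℝ 1 τ := hσ.contDiff.comp (contDiff_const.mul contDiff_id)
  have hτd : ∀ t, HasDerivAt τ ((L * 1) • deriv (fun t => (σ t : ℂ)) (L * t)) t := fun t =>
    ((hσ.contDiff.differentiable one_ne_zero) (L * t)).hasDerivAt.scomp t
      ((hasDerivAt_id t).const_mul L)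
  have hpos : ∀ t, 0 < (τ t).im := fun t => (σ (L * t)).im_pos
  have hL : 0 ≤ L := dist_nonneg
  refine ⟨fun t => Q (τ t), ?_, by simp [τ, h0], by simp [τ, h1],
    fun t _ => H.mem (σ (L * t)), ?_⟩
  · intro t _
    have : ContDiffAt ℝ 1 Q (τ t) := (H.analyticAt (hpos t)).contDiffAt.restrict_scalars ℝ
    exact (this.comp t hτ.contDiffAt).contDiffWithinAt
  · refine (Real.le_norm_self _).trans ?_
    have := intervalIntegral.norm_integral_le_of_norm_le_const (a := 0) (b := 1) (C := L)
      (f := fun t => lam (Q (τ t)) * ‖deriv (fun t => Q (τ t)) t‖) (fun t _ => ?_)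
    · simpa [curveLen] using this
    · have h2 : deriv (fun t => Q (τ t)) t = _ :=
        ((H.differentiableAt (τ t) (hpos t)).hasDerivAt.scomp t (hτd t)).deriv
      have h3 := H.density (σ (L * t))
      have h4 := hσ.norm_deriv_le (L * t)
      have h5 := (σ (L * t)).im_pos
      have h7 : ‖deriv (fun t => Q (τ t)) t‖ =
          L * ‖deriv (fun t => (σ t : ℂ)) (L * t)‖ * ‖deriv Q (τ t)‖ := by
        rw [h2, smul_eq_mul, norm_mul, mul_one, norm_smul, Real.norm_eq_abs, abs_of_nonneg hL]
      rw [h7]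
      have h6 : lam (Q (τ t)) * (L * ‖deriv (fun t => (σ t : ℂ)) (L * t)‖ * ‖deriv Q (τ t)‖) =
          L * (‖deriv (fun t => (σ t : ℂ)) (L * t)‖ / (σ (L * t)).im) := by
        calc _ = L * ‖deriv (fun t => (σ t : ℂ)) (L * t)‖ *
              (lam (Q (σ (L * t))) * ‖deriv Q (σ (L * t))‖) := by simp only [τ]; ring
          _ = _ := by rw [h3]; ring
      rw [h6, Real.norm_eq_abs, abs_of_nonneg (by positivity)]
      exact mul_le_of_le_one_right hL ((div_le_one h5).2 h4)

lemma densityDist_le_dist (H : IsHalfPlaneCover Ω lam Q) (z w : ℍ) :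
    densityDist Ω lam (Q z) (Q w) ≤ dist z w := by
  obtain ⟨γ, h1, h2, h3, h4, h5⟩ := H.exists_curve z w
  rw [← h2, ← h3]
  exact (H.densityDist_le_curveLen h1 h4).trans h5

lemma le_densityDist (H : IsHalfPlaneCover Ω lam Q) {x y : ℂ} (hx : x ∈ Ω) (hy : y ∈ Ω) {c : ℝ}
    (h : ∀ γ : ℝ → ℂ, ContDiffOn ℝ 1 γ (Icc 0 1) → γ 0 = x → γ 1 = y →
      (∀ t ∈ Icc (0:ℝ) 1, γ t ∈ Ω) → c ≤ curveLen lam γ) : c ≤ densityDist Ω lam x y := by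
  obtain ⟨z, rfl⟩ := H.surj x hx
  obtain ⟨w, rfl⟩ := H.surj y hy
  obtain ⟨γ, h1, h2, h3, h4, -⟩ := H.exists_curve z w
  refine le_csInf ⟨_, γ, h1, h2, h3, h4, rfl⟩ ?_
  rintro _ ⟨γ, h1, h2, h3, h4, rfl⟩
  exact h γ h1 h2 h3 h4

lemma frequently_slope_dist_lt (H : IsHalfPlaneCover Ω lam Q) {F : ℂ → ℂ} (hF : LipschitzWith 1 F)
    {γ : ℝ → ℂ} {η : ℝ → ℍ} {t : ℝ} {γ' : ℂ} (hγ : HasDerivWithinAt γ γ' (Ici t) t)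
    (hη : ContinuousWithinAt η (Ici t) t) (h : ∀ᶠ s in 𝓝[≥] t, Q (η s) = F (γ s)) (z : ℍ) {r : ℝ}
    (hr : lam (Q (η t)) * ‖γ'‖ < r) :
    ∃ᶠ s in 𝓝[>] t, slope (fun s => dist z (η s)) t s < r := by
  have hQ := H.hasStrictDerivAt (η t).im_pos
  have hne := H.deriv_ne_zero (η t)
  have hn := H.norm_deriv_pos (η t)
  have hi := (η t).im_pos
  have hlim : ContinuousAt
      (fun ε : ℝ => (‖deriv Q (η t)‖⁻¹ + ε) * (‖γ'‖ + ε) / ((η t).im - ε)) 0 := by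
    refine ContinuousAt.div (by fun_prop) (by fun_prop) ?_
    simpa using hi.ne'
  have hval : (‖deriv Q (η t)‖⁻¹ + 0) * (‖γ'‖ + 0) / ((η t).im - 0) < r := by
    rw [H.lam_eq] at hr
    refine lt_of_eq_of_lt ?_ hr
    simp only [add_zero, sub_zero]
    field_simp
  obtain ⟨ε, ⟨hε1, hε2⟩, hε0 : 0 < ε⟩ := ((((hlim.eventually (gt_mem_nhds hval)).and
    (gt_mem_nhds hi)).filter_mono nhdsWithin_le_nhds).and
      (self_mem_nhdsWithin (s := Ioi (0:ℝ)))).exists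
  obtain ⟨K, hK⟩ : ∃ K : NNReal, (K : ℝ) = ‖deriv Q (η t)‖⁻¹ + ε :=
    ⟨⟨_, by positivity⟩, rfl⟩
  obtain ⟨s₀, hs₀, hlip⟩ :=
    (hQ.to_localInverse hne).hasStrictFDerivAt.exists_lipschitzOnWith_of_nnnorm_lt K (by
      rw [← NNReal.coe_lt_coe, coe_nnnorm, ContinuousLinearMap.norm_toSpanSingleton, norm_inv, hK]
      linarith)
  have hηc : Tendsto (fun s => (η s : ℂ)) (𝓝[≥] t) (𝓝 (η t)) :=
    UpperHalfPlane.continuous_coe.continuousAt.comp_continuousWithinAt hη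
  have hQη : Tendsto (fun s => Q (η s)) (𝓝[≥] t) (𝓝 (Q (η t))) :=
    hQ.hasDerivAt.continuousAt.tendsto.comp hηc
  have hsqrt : Tendsto (fun s => √((η s).im * (η t).im)) (𝓝[≥] t) (𝓝 (η t).im) := by
    have h1 : Tendsto (fun s => (η s).im) (𝓝[≥] t) (𝓝 (η t).im) :=
      Complex.continuous_im.continuousAt.tendsto.comp hηc
    have h2 := (h1.mul_const (η t).im).sqrt
    rwa [Real.sqrt_mul_self hi.le] at h2
  have hev : ∀ᶠ s in 𝓝[≥] t, dist (η s) (η t) ≤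
      (‖deriv Q (η t)‖⁻¹ + ε) * ‖γ s - γ t‖ / ((η t).im - ε) := by
    filter_upwards [h, hηc.eventually (hQ.eventually_left_inverse hne), hQη.eventually hs₀,
      hsqrt.eventually (lt_mem_nhds (show (η t).im - ε < (η t).im by linarith))] with s a1 a2 a3 a4
    have b1 := hlip.dist_le_mul _ a3 _ (mem_of_mem_nhds hs₀)
    have e0 := (hQ.eventually_left_inverse hne).self_of_nhds
    rw [a2, e0, a1, h.self_of_nhdsWithin self_mem_Ici] at b1
    rw [hK] at b1
    have b2 := hF.dist_le_mul (γ s) (γ t)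
    rw [NNReal.coe_one, one_mul, dist_eq_norm (γ s)] at b2
    refine (UpperHalfPlane.dist_le_dist_coe_div_sqrt _ _).trans ?_
    refine div_le_div₀ (by positivity) (b1.trans ?_) (by linarith) a4.le
    exact mul_le_mul_of_nonneg_left b2 (by positivity)
  have hslope := hγ.limsup_norm_slope_le (show ‖γ'‖ < ‖γ'‖ + ε by linarith)
  have hle : 𝓝[>] t ≤ 𝓝[≥] t := nhdsWithin_mono _ Ioi_subset_Ici_self
  apply Eventually.frequently
  filter_upwards [hev.filter_mono hle, hslope.filter_mono hle, self_mem_nhdsWithin] with s c1 c2 c3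
  have hst : 0 < s - t := sub_pos.2 c3
  rw [Real.norm_eq_abs, abs_of_pos hst] at c2
  refine lt_of_le_of_lt ?_ hε1
  rw [slope_def_field]
  have c4 : dist z (η s) - dist z (η t) ≤ dist (η s) (η t) := by
    have := dist_triangle z (η t) (η s)
    rw [dist_comm (η t)] at this
    linarith
  calc (dist z (η s) - dist z (η t)) / (s - t)
      ≤ (‖deriv Q (η t)‖⁻¹ + ε) * ‖γ s - γ t‖ / ((η t).im - ε) / (s - t) := by
        gcongr
        exact c4.trans c1
    _ = (‖deriv Q (η t)‖⁻¹ + ε) * ((s - t)⁻¹ * ‖γ s - γ t‖) / ((η t).im - ε) := by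
        field_simp
    _ ≤ _ := by
        have : 0 < (η t).im - ε := by linarith
        gcongr

lemma dist_le_curveLen (H : IsHalfPlaneCover Ω lam Q) {F : ℂ → ℂ} (hF : IsDensityFold Ω lam F)
    {γ : ℝ → ℂ} (hc : ContDiffOn ℝ 1 γ (Icc 0 1)) (hγ : ∀ t ∈ Icc (0:ℝ) 1, γ t ∈ Ω)
    {η : ℝ → ℍ} (hη : ContinuousOn η (Icc 0 1)) (h : ∀ t ∈ Icc (0:ℝ) 1, Q (η t) = F (γ t)) :
    dist (η 0) (η 1) ≤ curveLen lam γ := by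
  set v : ℝ → ℝ := fun t => lam (γ t) * ‖derivWithin γ (Icc 0 1) t‖ with hv
  have hvc : ContinuousOn v (Icc 0 1) := by
    refine ContinuousOn.mul (fun t ht => ?_)
      (hc.continuousOn_derivWithin (uniqueDiffOn_Icc zero_lt_one) le_rfl).norm
    exact (H.continuousAt_lam (hγ t ht)).comp_continuousWithinAt (hc.continuousOn t ht)
  set V : ℝ → ℝ := fun t => v (projIcc 0 1 zero_le_one t) with hV
  have hVc : Continuous V :=
    hvc.comp_continuous (continuous_subtype_val.comp continuous_projIcc)
      fun t => (projIcc 0 1 _ t).2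
  have hVv : ∀ t ∈ Icc (0:ℝ) 1, V t = v t := fun t ht => by
    simp only [hV, projIcc_of_mem zero_le_one ht]
  set B : ℝ → ℝ := fun t => ∫ s in (0:ℝ)..t, V s with hB
  have hBd : ∀ t, HasDerivAt B (V t) t := fun t => (hVc.integral_hasStrictDerivAt 0 t).hasDerivAt
  have hB1 : B 1 = curveLen lam γ := by
    refine intervalIntegral.integral_congr_uIoo fun t ht => ?_
    rw [uIoo_of_le zero_le_one] at ht
    rw [hVv t (Ioo_subset_Icc_self ht)]
    simp only [hv, derivWithin_of_mem_nhds (Icc_mem_nhds ht.1 ht.2)]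
  rw [← hB1]
  refine image_le_of_liminf_slope_right_le_deriv_boundary (f := fun t => dist (η 0) (η t))
    (B := B) (B' := V) (a := 0) (b := 1)
    ((continuous_const.dist continuous_id).comp_continuousOn hη) (by simp [hB])
    (fun t _ => (hBd t).continuousAt.continuousWithinAt) (fun t _ => (hBd t).hasDerivWithinAt) ?_
    ⟨zero_le_one, le_rfl⟩
  intro t ht r hr
  have ht' : t ∈ Icc (0:ℝ) 1 := Ico_subset_Icc_self ht
  have hnhds : Icc (0:ℝ) 1 ∈ 𝓝[≥] t := by
    filter_upwards [Icc_mem_nhdsGE ht.2] with s hs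
    exact ⟨ht.1.trans hs.1, hs.2⟩
  refine H.frequently_slope_dist_lt hF.lipschitz (γ := γ) (γ' := derivWithin γ (Icc 0 1) t)
    ?_ ?_ ?_ (η 0) ?_
  · exact ((hc.differentiableOn one_ne_zero) t ht').hasDerivWithinAt.mono_of_mem_nhdsWithin hnhds
  · exact (hη t ht').mono_of_mem_nhdsWithin hnhds
  · filter_upwards [hnhds] with s hs using h s hs
  · rw [h t ht', hF.lam_eq _ (hγ t ht')]
    rwa [hVv t ht'] at hr

end IsHalfPlaneCover

namespace IsHalfPlaneCover

open UpperHalfPlane hiding I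

variable {Ω : Set ℂ} {lam : ℂ → ℝ} {Q : ℂ → ℂ}

lemma continuous_comp_coe (H : IsHalfPlaneCover Ω lam Q) : Continuous fun z : ℍ => Q z :=
  continuous_iff_continuousAt.2 fun z =>
    (H.differentiableAt z z.im_pos).continuousAt.comp UpperHalfPlane.continuous_coe.continuousAt

lemma exists_dist_le_densityDist (H : IsHalfPlaneCover Ω lam Q) {F : ℂ → ℂ}
    (hF : IsDensityFold Ω lam F) {x y : ℂ} (hx : x ∈ Ω) (hy : y ∈ Ω) {z : ℍ} (hz : Q z = F x) :
    ∃ w : ℍ, Q w = F y ∧ dist z w ≤ densityDist Ω lam x y := by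
  have hS : IsClosed {w : ℍ | Q w = F y} := isClosed_eq H.continuous_comp_coe continuous_const
  obtain ⟨w, hw, hd⟩ := hS.exists_infDist_eq_dist (H.surj _ (hF.mem y hy)) z
  refine ⟨w, hw, hd ▸ H.le_densityDist hx hy fun γ hc h0 h1 hγ => ?_⟩
  have hf : Continuous fun t : ℝ => F (γ (projIcc 0 1 zero_le_one t)) :=
    hF.lipschitz.continuous.comp (hc.continuousOn.comp_continuous
      (continuous_subtype_val.comp continuous_projIcc) fun t => (projIcc 0 1 _ t).2)
  obtain ⟨η, hη, hη0, hηQ⟩ := H.exists_lift hf (fun t => hF.mem _ (hγ _ (projIcc 0 1 _ t).2))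
    (a₀ := 0) (z₀ := z) (by simp [h0, hz])
  have hη1 : η 1 ∈ {w : ℍ | Q w = F y} := by simp [hηQ, h1]
  have := H.dist_le_curveLen hF hc hγ hη.continuousOn fun t ht => by
    rw [hηQ, projIcc_of_mem _ ht]
  rw [hη0] at this
  exact (infDist_le_dist_of_mem hη1).trans this

lemma exists_dist_le (H : IsHalfPlaneCover Ω lam Q) {y : ℂ} (z : ℍ) (hy : y ∈ Ω) :
    ∃ w : ℍ, Q w = y ∧ dist z w ≤ densityDist Ω lam (Q z) y :=
  H.exists_dist_le_densityDist (isDensityFold_id Ω lam) (H.mem z) hy rfl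

lemma densityDist_nonneg (H : IsHalfPlaneCover Ω lam Q) {x y : ℂ} (hx : x ∈ Ω) (hy : y ∈ Ω) :
    0 ≤ densityDist Ω lam x y :=
  H.le_densityDist hx hy fun _ _ _ _ h => H.curveLen_nonneg h

lemma densityDist_self (H : IsHalfPlaneCover Ω lam Q) {x : ℂ} (hx : x ∈ Ω) :
    densityDist Ω lam x x = 0 := by
  refine le_antisymm ?_ (H.densityDist_nonneg hx hx)
  obtain ⟨z, rfl⟩ := H.surj x hx
  simpa using H.densityDist_le_dist z z

lemma densityDist_comm (H : IsHalfPlaneCover Ω lam Q) {x y : ℂ} (hx : x ∈ Ω) (hy : y ∈ Ω) :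
    densityDist Ω lam x y = densityDist Ω lam y x := by
  have key : ∀ {x y : ℂ}, x ∈ Ω → y ∈ Ω → densityDist Ω lam y x ≤ densityDist Ω lam x y := by
    intro x y hx hy
    obtain ⟨z, rfl⟩ := H.surj x hx
    obtain ⟨w, rfl, h⟩ := H.exists_dist_le z hy
    exact (H.densityDist_le_dist w z).trans (dist_comm z w ▸ h)
  exact le_antisymm (key hy hx) (key hx hy)

lemma densityDist_triangle (H : IsHalfPlaneCover Ω lam Q) {x y z : ℂ} (hx : x ∈ Ω) (hy : y ∈ Ω)
    (hz : z ∈ Ω) : densityDist Ω lam x z ≤ densityDist Ω lam x y + densityDist Ω lam y z := by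
  obtain ⟨x, rfl⟩ := H.surj x hx
  obtain ⟨y, rfl, h1⟩ := H.exists_dist_le x hy
  obtain ⟨z, rfl, h2⟩ := H.exists_dist_le y hz
  exact (H.densityDist_le_dist x z).trans ((dist_triangle x y z).trans (add_le_add h1 h2))

lemma densityDist_fold_le (H : IsHalfPlaneCover Ω lam Q) {F : ℂ → ℂ} (hF : IsDensityFold Ω lam F)
    {x y : ℂ} (hx : x ∈ Ω) (hy : y ∈ Ω) :
    densityDist Ω lam (F x) (F y) ≤ densityDist Ω lam x y := by
  obtain ⟨z, hz⟩ := H.surj _ (hF.mem x hx)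
  obtain ⟨w, hw, h⟩ := H.exists_dist_le_densityDist hF hx hy hz
  rw [← hz, ← hw]
  exact (H.densityDist_le_dist z w).trans h

lemma exists_isGeodesicIn (H : IsHalfPlaneCover Ω lam Q) {x y : ℂ} (hx : x ∈ Ω) (hy : y ∈ Ω) :
    ∃ g, IsGeodesicIn Ω (densityDist Ω lam) g x y := by
  obtain ⟨z, rfl⟩ := H.surj x hx
  obtain ⟨w, rfl, h⟩ := H.exists_dist_le z hy
  have hd : densityDist Ω lam (Q z) (Q w) = dist z w := le_antisymm (H.densityDist_le_dist z w) h
  obtain ⟨σ, hσ, h0, h1⟩ := exists_isHyperbolicLine_from z w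
  have hle : ∀ s t, densityDist Ω lam (Q (σ s)) (Q (σ t)) ≤ |s - t| := fun s t =>
    (H.densityDist_le_dist _ _).trans_eq (hσ.isometry.dist_eq s t)
  have key : ∀ s ∈ Icc (0:ℝ) (dist z w), ∀ t ∈ Icc (0:ℝ) (dist z w), s ≤ t →
      densityDist Ω lam (Q (σ s)) (Q (σ t)) = |s - t| := by
    intro s hs t ht hst
    refine le_antisymm (hle s t) ?_
    have e1 := H.densityDist_triangle (H.mem z) (H.mem (σ s)) (H.mem w)
    have e2 := H.densityDist_triangle (H.mem (σ s)) (H.mem (σ t)) (H.mem w)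
    have e3 := hle 0 s
    have e4 := hle t (dist z w)
    rw [h0, zero_sub, abs_neg, abs_of_nonneg hs.1] at e3
    rw [h1, abs_sub_comm, abs_of_nonneg (sub_nonneg.2 ht.2)] at e4
    rw [abs_sub_comm, abs_of_nonneg (sub_nonneg.2 hst)]
    linarith
  refine ⟨fun t => Q (σ t), by simp [h0], by simp [hd, h1], fun t _ => H.mem _, ?_⟩
  rw [hd]
  intro s hs t ht
  rcases le_total s t with hst | hst
  · exact key s hs t ht hst
  · rw [H.densityDist_comm (H.mem _) (H.mem _), abs_sub_comm]
    exact key t ht s hs hst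

lemma continuousOn_of_isGeodesicIn (H : IsHalfPlaneCover Ω lam Q) {x y : ℂ} {g : ℝ → ℂ}
    (hg : IsGeodesicIn Ω (densityDist Ω lam) g x y) :
    ContinuousOn g (Icc 0 (densityDist Ω lam x y)) := by
  intro t₀ ht₀
  obtain ⟨-, -, hmem, hdist⟩ := hg
  obtain ⟨z, hz⟩ := H.surj _ (hmem t₀ ht₀)
  have hex : ∀ t ∈ Icc 0 (densityDist Ω lam x y), ∃ w : ℍ, Q w = g t ∧ dist z w ≤ |t₀ - t| := by
    intro t ht
    obtain ⟨w, h1, h2⟩ := H.exists_dist_le z (hmem t ht)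
    rw [hz, hdist t₀ ht₀ t ht] at h2
    exact ⟨w, h1, h2⟩
  choose! w hw hwd using hex
  have hlim : Tendsto w (𝓝[Icc 0 (densityDist Ω lam x y)] t₀) (𝓝 z) := by
    rw [tendsto_iff_dist_tendsto_zero]
    have h1 : Tendsto (fun t => |t₀ - t|) (𝓝[Icc 0 (densityDist Ω lam x y)] t₀) (𝓝 0) := by
      have : Continuous fun t : ℝ => |t₀ - t| := by fun_prop
      simpa using (this.tendsto t₀).mono_left nhdsWithin_le_nhds
    refine squeeze_zero' (Eventually.of_forall fun _ => dist_nonneg) ?_ h1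
    filter_upwards [self_mem_nhdsWithin] with t ht
    rw [dist_comm]
    exact hwd t ht
  have h2 : Tendsto (fun t => Q (w t)) (𝓝[Icc 0 (densityDist Ω lam x y)] t₀) (𝓝 (Q z)) :=
    (H.continuous_comp_coe.tendsto z).comp hlim
  rw [ContinuousWithinAt, ← hz]
  refine h2.congr' ?_
  filter_upwards [self_mem_nhdsWithin] with t ht using hw t ht

lemma exists_section (H : IsHalfPlaneCover Ω lam Q) (hΩo : IsOpen Ω)
    (hup : ∀ z : ℂ, 0 < z.im → z ∈ Ω) {G : ℂ → ℂ} (hG : IsDensityFold Ω lam G) {x : ℂ}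
    (hx : x ∈ Ω) (hxi : 0 ≤ x.im) {z : ℍ} (hz : Q z = G x) :
    ∃ s : ℂ → ℍ, ContinuousOn s {a | a ∈ Ω ∧ 0 ≤ a.im} ∧ s x = z ∧
      ∀ a ∈ Ω, 0 ≤ a.im → Q (s a) = G a := by
  set V : Set ℂ := {a | ∀ t ∈ Icc (0:ℝ) 1, I + (t:ℂ) * (a - I) ∈ Ω} with hV
  have hVΩ : ∀ a ∈ V, a ∈ Ω := fun a ha => by simpa using ha 1 (by simp)
  have hPV : ∀ a ∈ Ω, 0 ≤ a.im → a ∈ V := by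
    intro a ha hai t ht
    rcases ht.2.lt_or_eq with h1 | rfl
    · refine hup _ ?_
      have : (I + (t:ℂ) * (a - I)).im = (1 - t) + t * a.im := by simp; ring
      rw [this]
      have := mul_nonneg ht.1 hai
      linarith
    · simpa using ha
  have hVo : IsOpen V := by
    rw [isOpen_iff_eventually]
    intro a ha
    refine isCompact_Icc.eventually_forall_of_forall_eventually fun t ht => ?_
    have hc : Continuous fun p : ℂ × ℝ => I + (p.2:ℂ) * (p.1 - I) := by fun_prop
    exact hc.continuousAt.eventually (hΩo.mem_nhds (ha t ht))
  have hVs : StarConvex ℝ I V := by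
    rw [starConvex_iff_forall_pos (fun t _ => by simpa using hup I (by simp))]
    intro a ha p q hp hq hpq t ht
    have := ha (t * q) ⟨mul_nonneg ht.1 hq.le, mul_le_one₀ ht.2 hq.le (by linarith)⟩
    have hp' : (p:ℂ) = 1 - q := by
      rw [← ofReal_one, ← ofReal_sub, ofReal_inj]; linarith
    convert this using 1
    simp only [real_smul, hp', ofReal_mul]
    ring
  have hne : V.Nonempty := ⟨x, hPV x hx hxi⟩
  have : ContractibleSpace V := hVs.contractibleSpace hne
  have : LocallyPathConnectedSpace V := hVo.locallyPathConnectedSpace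
  obtain ⟨s, hs, hs0, hsQ⟩ := H.exists_lift (A := V) (f := fun a => G a)
    (hG.lipschitz.continuous.comp continuous_subtype_val) (fun a => hG.mem _ (hVΩ a a.2))
    (a₀ := ⟨x, hPV x hx hxi⟩) hz
  classical
  let S : ℂ → ℍ := fun a => if ha : a ∈ V then s ⟨a, ha⟩ else z
  have hS : ∀ a (ha : a ∈ V), S a = s ⟨a, ha⟩ := fun a ha => dif_pos ha
  refine ⟨S, ContinuousOn.mono (s := V) ?_ fun a ha => hPV a ha.1 ha.2, ?_, fun a ha hai => ?_⟩
  · rw [continuousOn_iff_continuous_domRestrict]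
    refine hs.congr fun a => (hS a a.2).symm
  · rw [hS _ (hPV x hx hxi), hs0]
  · rw [hS _ (hPV a ha hai), hsQ]

lemma dist_section_le (H : IsHalfPlaneCover Ω lam Q) (hΩ : ∀ x ∈ Ω, conj x ∈ Ω) {G : ℂ → ℂ}
    (hG : IsDensityFold Ω lam G) {s : ℂ → ℍ} (hs : ContinuousOn s {a | a ∈ Ω ∧ 0 ≤ a.im})
    (hsQ : ∀ a ∈ Ω, 0 ≤ a.im → Q (s a) = G a) {a b : ℂ} (ha : a ∈ Ω) (hb : b ∈ Ω)
    (hai : 0 ≤ a.im) (hbi : 0 ≤ b.im) : dist (s a) (s b) ≤ densityDist Ω lam a b := by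
  have hfold := H.isDensityFold_foldUp hΩ
  refine H.le_densityDist ha hb fun γ hc h0 h1 hγ => ?_
  have := H.dist_le_curveLen (hG.comp hfold) hc hγ (η := fun t => s (foldUp (γ t))) ?_ ?_
  · simpa only [h0, h1, foldUp_of_nonneg hai, foldUp_of_nonneg hbi] using this
  · exact hs.comp (lipschitzWith_foldUp.continuous.comp_continuousOn hc.continuousOn)
      fun t ht => ⟨hfold.mem _ (hγ t ht), foldUp_im_nonneg _⟩
  · exact fun t ht => hsQ _ (hfold.mem _ (hγ t ht)) (foldUp_im_nonneg _)

lemma densityDist_four_point (H : IsHalfPlaneCover Ω lam Q) (hΩo : IsOpen Ω)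
    (hup : ∀ z : ℂ, 0 < z.im → z ∈ Ω) (hΩ : ∀ x ∈ Ω, conj x ∈ Ω) {a b c e : ℂ} (ha : a ∈ Ω)
    (hb : b ∈ Ω) (hc : c ∈ Ω) (he : e ∈ Ω) (hai : 0 ≤ a.im) (hbi : 0 ≤ b.im) (hci : 0 ≤ c.im)
    (hei : 0 ≤ e.im) :
    densityDist Ω lam a c + densityDist Ω lam b e ≤
      max (densityDist Ω lam a b + densityDist Ω lam c e)
        (densityDist Ω lam a e + densityDist Ω lam b c) + 6 := by
  obtain ⟨z, hz⟩ := H.surj a ha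
  obtain ⟨s, hs, -, hsQ⟩ := H.exists_section hΩo hup (isDensityFold_id Ω lam) ha hai hz
  have key : ∀ x ∈ Ω, ∀ y ∈ Ω, 0 ≤ x.im → 0 ≤ y.im →
      densityDist Ω lam x y = dist (s x) (s y) := by
    intro x hx y hy hxi hyi
    refine le_antisymm ?_ (H.dist_section_le hΩ (isDensityFold_id Ω lam) hs hsQ hx hy hxi hyi)
    have := H.densityDist_le_dist (s x) (s y)
    rwa [hsQ x hx hxi, hsQ y hy hyi] at this
  rw [key a ha c hc hai hci, key b hb e he hbi hei, key a ha b hb hai hbi, key c hc e he hci hei,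
    key a ha e he hai hei, key b hb c hc hbi hci]
  exact UpperHalfPlane.dist_add_dist_le_max _ _ _ _

lemma densityDist_conj_le (H : IsHalfPlaneCover Ω lam Q) (hΩo : IsOpen Ω)
    (hup : ∀ z : ℂ, 0 < z.im → z ∈ Ω) (hΩ : ∀ x ∈ Ω, conj x ∈ Ω) {x y w : ℂ} (hx : x ∈ Ω)
    (hy : y ∈ Ω) (hxi : x.im = 0) (hyi : y.im = 0)
    (hxy : ∀ r ∈ uIcc x.re y.re, (r : ℂ) ∈ Ω) (hw : w ∈ Ω) (hwi : 0 ≤ w.im)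
    (h : densityDist Ω lam x w + densityDist Ω lam w y = densityDist Ω lam x y) :
    densityDist Ω lam w (conj w) ≤ 6 := by
  have hconj := H.isDensityFold_conj hΩ
  have hxr : ((x.re : ℝ) : ℂ) = x := Complex.ext rfl (by simp [hxi])
  have hyr : ((y.re : ℝ) : ℂ) = y := Complex.ext rfl (by simp [hyi])
  obtain ⟨z, hz⟩ := H.surj x hx
  obtain ⟨s, hs, hsx, hsQ⟩ := H.exists_section hΩo hup (isDensityFold_id Ω lam) hx hxi.ge hz
  obtain ⟨s', hs', hsx', hsQ'⟩ := H.exists_section hΩo hup hconj hx hxi.ge (z := z)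
    (by rw [hz, Complex.conj_eq_iff_im.2 hxi])
  have hmaps : MapsTo (fun r : ℝ => (r : ℂ)) (uIcc x.re y.re) {a | a ∈ Ω ∧ 0 ≤ a.im} :=
    fun r hr => ⟨hxy r hr, by simp⟩
  have heq : EqOn (fun r : ℝ => s r) (fun r : ℝ => s' r) (uIcc x.re y.re) := by
    refine H.lift_eqOn isPreconnected_uIcc
      (hs.comp Complex.continuous_ofReal.continuousOn hmaps)
      (hs'.comp Complex.continuous_ofReal.continuousOn hmaps) (fun r hr => ?_) left_mem_uIcc ?_
    · rw [hsQ _ (hxy r hr) (by simp), hsQ' _ (hxy r hr) (by simp)]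
      simp
    · rw [hxr, hsx, hsx']
  have hsy : s y = s' y := by simpa only [hyr] using heq right_mem_uIcc
  have d1 := H.dist_section_le hΩ (isDensityFold_id Ω lam) hs hsQ hx hw hxi.ge hwi
  have d2 := H.dist_section_le hΩ (isDensityFold_id Ω lam) hs hsQ hw hy hwi hyi.ge
  have d3 := H.dist_section_le hΩ hconj hs' hsQ' hx hw hxi.ge hwi
  have d4 := H.dist_section_le hΩ hconj hs' hsQ' hw hy hwi hyi.ge
  have d5 := H.densityDist_le_dist (s x) (s y)
  have d6 := H.densityDist_le_dist (s w) (s' w)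
  rw [hsQ x hx hxi.ge, hsQ y hy hyi.ge, id, id] at d5
  rw [hsQ w hw hwi, hsQ' w hw hwi, id] at d6
  rw [← hsy] at d4
  rw [hsx'.trans hsx.symm] at d3
  have key := UpperHalfPlane.dist_add_dist_le_max (s x) (s w) (s y) (s' w)
  rw [dist_comm (s y)] at key
  rcases le_total (dist (s x) (s w) + dist (s' w) (s y)) (dist (s x) (s' w) + dist (s w) (s y))
    with hm | hm
  · rw [max_eq_right hm] at key
    linarith
  · rw [max_eq_left hm] at key
    linarith

theorem isFoldedMetric (H : IsHalfPlaneCover Ω lam Q) (hΩo : IsOpen Ω)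
    (hup : ∀ z : ℂ, 0 < z.im → z ∈ Ω) (hΩ : ∀ x ∈ Ω, conj x ∈ Ω) :
    IsFoldedMetric Ω (densityDist Ω lam) 6 where
  const_nonneg := by norm_num
  dist_self _ hx := H.densityDist_self hx
  symm _ hx _ hy := H.densityDist_comm hx hy
  triangle _ hx _ hy _ hz := H.densityDist_triangle hx hy hz
  conj_mem := hΩ
  conj_le _ hx _ hy := H.densityDist_fold_le (H.isDensityFold_conj hΩ) hx hy
  fold_le _ hx _ hy := H.densityDist_fold_le (H.isDensityFold_foldUp hΩ) hx hy
  exists_geodesic _ hx _ hy := H.exists_isGeodesicIn hx hy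
  continuousOn_im _ _ _ _ _ hg :=
    Complex.continuous_im.comp_continuousOn (H.continuousOn_of_isGeodesicIn hg)
  four_point _ ha _ hb _ hc _ he hai hbi hci hei :=
    H.densityDist_four_point hΩo hup hΩ ha hb hc he hai hbi hci hei
  conj_near _ hx _ hy hxi hyi hxy _ hw hwi h :=
    H.densityDist_conj_le hΩo hup hΩ hx hy hxi hyi hxy hw hwi h

end IsHalfPlaneCover

lemma IsDenjoyDomain.mem_of_im_ne_zero {Ω : Set ℂ} (h : IsDenjoyDomain Ω) {r : ℝ}
    (hr : (r : ℂ) ∈ Ω) {z : ℂ} (hz : z.im ≠ 0) : z ∈ Ω := by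
  obtain ⟨hopen, -, hfr⟩ := h
  have hsub : ∀ s : Set ℂ, IsPreconnected s → (∀ z ∈ s, z.im ≠ 0) → (s ∩ Ω).Nonempty → s ⊆ Ω := by
    intro s hs hsi hne
    refine hs.subset_of_closure_inter_subset hopen hne fun w hw => ?_
    by_contra hwΩ
    exact hsi w hw.2 (hfr ⟨hw.1, fun h => hwΩ (interior_subset h)⟩)
  have hnear : ∀ᶠ t : ℝ in 𝓝 0, (r : ℂ) + t * I ∈ Ω := by
    have hc : ContinuousAt (fun t : ℝ => (r : ℂ) + t * I) 0 := by fun_prop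
    exact hc.eventually (hopen.mem_nhds (by simpa using hr))
  rcases hz.lt_or_gt with hlt | hgt
  · obtain ⟨t, h1, h2⟩ := ((hnear.filter_mono nhdsWithin_le_nhds).and
      (self_mem_nhdsWithin (s := Iio (0:ℝ)))).exists
    exact hsub {z | z.im < 0} (convex_halfSpace_im_lt 0).isPreconnected (fun z hz => ne_of_lt hz)
      ⟨_, by simpa using h2, h1⟩ hlt
  · obtain ⟨t, h1, h2⟩ := ((hnear.filter_mono nhdsWithin_le_nhds).and
      (self_mem_nhdsWithin (s := Ioi (0:ℝ)))).exists
    exact hsub {z | 0 < z.im} (convex_halfSpace_im_gt 0).isPreconnected (fun z hz => ne_of_gt hz)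
      ⟨_, by simpa using h2, h1⟩ hgt

theorem IsDenjoyDomain.isFoldedMetric {Ω : Set ℂ} {lam : ℂ → ℝ} (h : IsDenjoyDomain Ω)
    (hlam : IsPoincareDensity Ω lam) {r : ℝ} (hr : (r : ℂ) ∈ Ω) :
    IsFoldedMetric Ω (densityDist Ω lam) 6 := by
  obtain ⟨Q, H⟩ := hlam.exists_halfPlaneCover
  refine H.isFoldedMetric h.1 (fun z hz => h.mem_of_im_ne_zero hr hz.ne') fun z hz => ?_
  by_cases hzi : z.im = 0
  · rwa [Complex.conj_eq_iff_im.2 hzi]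
  · exact h.mem_of_im_ne_zero hr (by simpa using hzi)

end Covering

/-- Theorem 3.3 for the Poincaré metric: the four conditions are equivalent, with each
constant bounded in terms of any other (via the universal functions `F₁₂, F₂₃, F₃₄, F₄₁`). -/
theorem denjoy_poincare_characterization :
    ∃ F12 F23 F34 F41 : ℝ → ℝ,
      ∀ (Ω : Set ℂ) (I : ℕ → Set ℝ) (lam : ℂ → ℝ),
        IsDenjoyDomain Ω →
        IsPoincareDensity Ω lam →
        (∀ n, (I n).Nonempty ∧ IsOpen (I n) ∧ (I n).OrdConnected) →
        Pairwise (Function.onFun Disjoint I) →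
        (fun x : ℝ => (x : ℂ)) ⁻¹' Ω = (⋃ n, I n) →
        (∀ δ : ℝ, GromovHyperbolicWith Ω (densityDist Ω lam) δ →
          DenjoyCondAllFund Ω (densityDist Ω lam) I (F12 δ)) ∧
        (∀ c : ℝ, DenjoyCondAllFund Ω (densityDist Ω lam) I c →
          DenjoyCondSomeFund Ω (densityDist Ω lam) I (F23 c)) ∧
        (∀ c : ℝ, DenjoyCondSomeFund Ω (densityDist Ω lam) I c →
          DenjoyCondBigon Ω (densityDist Ω lam) (F34 c)) ∧
        (∀ c : ℝ, DenjoyCondBigon Ω (densityDist Ω lam) c →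
          GromovHyperbolicWith Ω (densityDist Ω lam) (F41 c)) := by
  refine ⟨id, id, fun c => 46 * 6 + 4 * (|c| + 1), fun c => 7 * (2 * 6 + 4 * c) + 3,
    fun Ω I lam hΩ hlam hI _ hIΩ => ?_⟩
  obtain ⟨r, hr⟩ := (hI 0).1
  have hrΩ : (r : ℂ) ∈ Ω := by
    have : r ∈ ⋃ n, I n := mem_iUnion.2 ⟨0, hr⟩
    rwa [← hIΩ] at this
  have M := hΩ.isFoldedMetric hlam hrΩ
  exact ⟨fun _ h => M.condAllFund_of_gromovHyperbolic h,
    fun _ h => M.condSomeFund_of_condAllFund (fun n => (hI n).1) hIΩ h,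
    fun _ h => M.condBigon_of_condSomeFund (fun n => (hI n).2.2) hIΩ h,
    fun _ h => M.gromovHyperbolic_of_condBigon (hI 0).1 hIΩ h⟩

end
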